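/- Let β > −1 and q ≥ 0. Suppose w and f are smooth functions on {0 < ρ ≤ 1} (2π-periodic in θ), w is bounded, f has an expansion up to order q, and △̃w = f on {0 < ρ ≤ 1}. Then w has an expansion up to order q' for every q' < 2 + q; if moreover q ≠ k/(β+1) − 2 for every nonnegative integer k, then w has an expansion up to order 2 + q. -/

import Mathlib

open Real Set

/-- The operator `ρ ∂/∂ρ` on functions `u(ρ,θ)`. -/
noncomputable def pdRho (u : ℝ → ℝ → ℝ) : ℝ → ℝ → ℝ :=
  fun ρ θ => ρ * deriv (fun r => u r θ) ρ

/-- The operator `∂/∂θ` on functions `u(ρ,θ)`. -/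
noncomputable def pdTheta (u : ℝ → ℝ → ℝ) : ℝ → ℝ → ℝ :=
  fun ρ θ => deriv (fun s => u ρ s) θ

/-- `∂/∂ρ` taken within `(0,1]` (one-sided at `ρ = 1`). -/
noncomputable def dR (u : ℝ → ℝ → ℝ) : ℝ → ℝ → ℝ :=
  fun ρ θ => derivWithin (fun r => u r θ) (Set.Ioc 0 1) ρ

/-- The cone Laplacian `△̃ = ∂²/∂ρ² + ρ⁻¹ ∂/∂ρ + (β+1)⁻² ρ⁻² ∂²/∂θ²` for functions
defined on `{0 < ρ ≤ 1}`. -/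
noncomputable def coneLapW (β : ℝ) (u : ℝ → ℝ → ℝ) (ρ θ : ℝ) : ℝ :=
  dR (dR u) ρ θ + ρ⁻¹ * dR u ρ θ
    + ((β + 1) ^ 2)⁻¹ * (ρ ^ 2)⁻¹ * pdTheta (pdTheta u) ρ θ

/-- The class `Õ(q)` on `{0 < ρ < 1/2}`. -/
def Otilde (q : ℝ) (u : ℝ → ℝ → ℝ) : Prop :=
  ∀ k₁ k₂ : ℕ, ∃ C : ℝ, ∀ ρ θ : ℝ, 0 < ρ → ρ < 1 / 2 →
    |pdRho^[k₁] (pdTheta^[k₂] u) ρ θ| ≤ C * ρ ^ q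

/-- The index `(j,k,l)` contributes to `T^q`. -/
def goodIdx (β q : ℝ) (j k l : ℕ) : Prop :=
  (∃ m : ℕ, k = l + 2 * m) ∧ 2 * (j : ℝ) + (k : ℝ) / (β + 1) < q

/-- The (finitely supported) sum over `T^q`. -/
noncomputable def expSum (β : ℝ) (a b : ℕ → ℕ → ℕ → ℝ) : ℝ → ℝ → ℝ :=
  fun ρ θ => ∑ᶠ i : ℕ × ℕ × ℕ,
    (a i.1 i.2.1 i.2.2 * ρ ^ (2 * (i.1 : ℝ) + (i.2.1 : ℝ) / (β + 1)) * Real.cos (i.2.2 * θ)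
      + b i.1 i.2.1 i.2.2 * ρ ^ (2 * (i.1 : ℝ) + (i.2.1 : ℝ) / (β + 1)) * Real.sin (i.2.2 * θ))

/-- `u` has an expansion up to order `q`. -/
def HasExpansion (β q : ℝ) (u : ℝ → ℝ → ℝ) : Prop :=
  ∃ a b : ℕ → ℕ → ℕ → ℝ,
    (∀ j k l : ℕ, ¬ goodIdx β q j k l → a j k l = 0 ∧ b j k l = 0) ∧
    Otilde q (fun ρ θ => u ρ θ - expSum β a b ρ θ)

namespace ConeAux

/-- smoothness on the open region `0 < ρ < 1`. -/
def Sm (u : ℝ → ℝ → ℝ) : Prop :=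
  ContDiffOn ℝ (⊤ : ℕ∞) (fun p : ℝ × ℝ => u p.1 p.2) (Ioo (0:ℝ) 1 ×ˢ (univ : Set ℝ))

/-- equality on the open region. -/
def EqOm (u v : ℝ → ℝ → ℝ) : Prop := ∀ ρ ∈ Ioo (0:ℝ) 1, ∀ θ, u ρ θ = v ρ θ

/-- mixed iterated derivative. -/
noncomputable def DD (k₁ k₂ : ℕ) (u : ℝ → ℝ → ℝ) : ℝ → ℝ → ℝ := pdRho^[k₁] (pdTheta^[k₂] u)

/-- the basic terms. -/
noncomputable def E (c : ℂ) (s : ℝ) (l : ℤ) : ℝ → ℝ → ℝ :=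
  fun ρ θ => (c * Complex.exp (Complex.I * l * θ)).re * ρ ^ s

lemma isOpen_Om : IsOpen (Ioo (0:ℝ) 1 ×ˢ (univ : Set ℝ)) := isOpen_Ioo.prod isOpen_univ

lemma Sm.contDiffAt {u} (h : Sm u) {ρ : ℝ} (hρ : ρ ∈ Ioo (0:ℝ) 1) (θ : ℝ) :
    ContDiffAt ℝ (⊤ : ℕ∞) (fun p : ℝ × ℝ => u p.1 p.2) (ρ, θ) :=
  ContDiffOn.contDiffAt h (isOpen_Om.mem_nhds ⟨hρ, mem_univ _⟩)

lemma Sm.hasRho {u} (h : Sm u) {ρ : ℝ} (hρ : ρ ∈ Ioo (0:ℝ) 1) (θ : ℝ) :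
    HasDerivAt (fun r => u r θ) (fderiv ℝ (fun p : ℝ × ℝ => u p.1 p.2) (ρ, θ) (1, 0)) ρ := by
  have h1 := ((h.contDiffAt hρ θ).differentiableAt (by simp)).hasFDerivAt
  have h2 : HasDerivAt (fun r : ℝ => (r, θ)) ((1:ℝ), (0:ℝ)) ρ :=
    (hasDerivAt_id ρ).prodMk (hasDerivAt_const ρ θ)
  exact HasFDerivAt.comp_hasDerivAt (f := fun r : ℝ => (r, θ)) ρ h1 h2

lemma Sm.hasTheta {u} (h : Sm u) {ρ : ℝ} (hρ : ρ ∈ Ioo (0:ℝ) 1) (θ : ℝ) :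
    HasDerivAt (fun s => u ρ s) (fderiv ℝ (fun p : ℝ × ℝ => u p.1 p.2) (ρ, θ) (0, 1)) θ := by
  have h1 := ((h.contDiffAt hρ θ).differentiableAt (by simp)).hasFDerivAt
  have h2 : HasDerivAt (fun r : ℝ => (ρ, r)) ((0:ℝ), (1:ℝ)) θ :=
    (hasDerivAt_const θ ρ).prodMk (hasDerivAt_id θ)
  exact HasFDerivAt.comp_hasDerivAt (f := fun r : ℝ => (ρ, r)) θ h1 h2

lemma Sm.pdRho {u} (h : Sm u) : Sm (pdRho u) := by
  have h1 : ContDiffOn ℝ (⊤ : ℕ∞) (fderiv ℝ (fun p : ℝ × ℝ => u p.1 p.2)) _ :=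
    ContDiffOn.fderiv_of_isOpen h isOpen_Om (by simp)
  have h2 : ContDiffOn ℝ (⊤ : ℕ∞) (fun p : ℝ × ℝ => p.1 *
      fderiv ℝ (fun p : ℝ × ℝ => u p.1 p.2) p (1, 0)) (Ioo (0:ℝ) 1 ×ˢ (univ : Set ℝ)) :=
    contDiff_fst.contDiffOn.mul (h1.clm_apply contDiffOn_const)
  refine h2.congr ?_
  rintro ⟨ρ, θ⟩ ⟨hρ, -⟩
  simp only [_root_.pdRho]
  rw [(h.hasRho hρ θ).deriv]

lemma Sm.pdTheta {u} (h : Sm u) : Sm (pdTheta u) := by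
  have h1 : ContDiffOn ℝ (⊤ : ℕ∞) (fderiv ℝ (fun p : ℝ × ℝ => u p.1 p.2)) _ :=
    ContDiffOn.fderiv_of_isOpen h isOpen_Om (by simp)
  have h2 : ContDiffOn ℝ (⊤ : ℕ∞) (fun p : ℝ × ℝ => 
      fderiv ℝ (fun p : ℝ × ℝ => u p.1 p.2) p (0, 1)) (Ioo (0:ℝ) 1 ×ˢ (univ : Set ℝ)) :=
    (h1.clm_apply contDiffOn_const)
  refine h2.congr ?_
  rintro ⟨ρ, θ⟩ ⟨hρ, -⟩
  simp only [_root_.pdTheta]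
  rw [(h.hasTheta hρ θ).deriv]

lemma Sm.hasRho' {u} (h : Sm u) {ρ : ℝ} (hρ : ρ ∈ Ioo (0:ℝ) 1) (θ : ℝ) :
    HasDerivAt (fun r => u r θ) (ρ⁻¹ * _root_.pdRho u ρ θ) ρ := by
  have := h.hasRho hρ θ
  simp only [_root_.pdRho]
  rw [this.deriv, inv_mul_cancel_left₀ hρ.1.ne']
  exact this

lemma Sm.hasTheta' {u} (h : Sm u) {ρ : ℝ} (hρ : ρ ∈ Ioo (0:ℝ) 1) (θ : ℝ) :
    HasDerivAt (fun s => u ρ s) (_root_.pdTheta u ρ θ) θ := by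
  have := h.hasTheta hρ θ
  simp only [_root_.pdTheta]
  rw [this.deriv]
  exact this

lemma Sm.iterRho {u} (h : Sm u) (k : ℕ) : Sm (_root_.pdRho^[k] u) := by
  induction k with
  | zero => exact h
  | succ k ih => rw [Function.iterate_succ_apply']; exact ih.pdRho

lemma Sm.iterTheta {u} (h : Sm u) (k : ℕ) : Sm (_root_.pdTheta^[k] u) := by
  induction k with
  | zero => exact h
  | succ k ih => rw [Function.iterate_succ_apply']; exact ih.pdTheta

lemma Sm.DD {u} (h : Sm u) (k₁ k₂ : ℕ) : Sm (DD k₁ k₂ u) := (h.iterTheta k₂).iterRho k₁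

lemma Sm.add {u v} (h : Sm u) (h' : Sm v) : Sm (u + v) := ContDiffOn.add h h'

lemma Sm.smul {u} (a : ℝ) (h : Sm u) : Sm (a • u) := ContDiffOn.const_smul a h

lemma Sm.sub {u v} (h : Sm u) (h' : Sm v) : Sm (u - v) := ContDiffOn.sub h h'

lemma Sm.zero : Sm 0 := contDiffOn_const

lemma Sm.sum {ι : Type*} (I : Finset ι) (F : ι → ℝ → ℝ → ℝ) (h : ∀ i ∈ I, Sm (F i)) :
    Sm (∑ i ∈ I, F i) := by
  classical
  induction I using Finset.induction_on with
  | empty => exact Sm.zero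
  | insert a s ha ih =>
    rw [Finset.sum_insert ha]
    exact (h a (by simp)).add (ih fun i hi => h i (by simp [hi]))

lemma Sm.E (c : ℂ) (s : ℝ) (l : ℤ) : Sm (E c s l) := by
  refine ContDiffOn.mul ?_ ?_
  · apply ContDiff.contDiffOn
    have : ContDiff ℝ (⊤ : ℕ∞) (fun p : ℝ × ℝ => c * Complex.exp (Complex.I * l * (p.2 : ℝ))) := by
      apply contDiff_const.mul
      apply ContDiff.cexp
      apply contDiff_const.mul
      exact Complex.ofRealCLM.contDiff.comp contDiff_snd
    exact Complex.reCLM.contDiff.comp this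
  · refine ContDiffOn.rpow_const_of_ne contDiff_fst.contDiffOn ?_
    rintro ⟨ρ, θ⟩ ⟨hρ, -⟩
    exact hρ.1.ne'

lemma EqOm.refl (u) : EqOm u u := fun _ _ _ => rfl
lemma EqOm.symm {u v} (h : EqOm u v) : EqOm v u := fun ρ hρ θ => (h ρ hρ θ).symm
lemma EqOm.trans {u v w} (h : EqOm u v) (h' : EqOm v w) : EqOm u w :=
  fun ρ hρ θ => (h ρ hρ θ).trans (h' ρ hρ θ)

lemma EqOm.sm {u v} (h : EqOm u v) (hv : Sm v) : Sm u :=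
  ContDiffOn.congr hv (by rintro ⟨ρ, θ⟩ ⟨hρ, -⟩; exact h ρ hρ θ)

lemma EqOm.pdRho {u v} (h : EqOm u v) : EqOm (pdRho u) (pdRho v) := by
  intro ρ hρ θ
  simp only [_root_.pdRho]
  congr 1
  apply Filter.EventuallyEq.deriv_eq
  filter_upwards [isOpen_Ioo.mem_nhds hρ] with r hr using h r hr θ

lemma EqOm.pdTheta {u v} (h : EqOm u v) : EqOm (pdTheta u) (pdTheta v) := by
  intro ρ hρ θ
  simp only [_root_.pdTheta]
  congr 1
  ext s
  exact h ρ hρ s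

lemma EqOm.iterRho {u v} (h : EqOm u v) (k : ℕ) :
    EqOm (_root_.pdRho^[k] u) (_root_.pdRho^[k] v) := by
  induction k with
  | zero => exact h
  | succ k ih => rw [Function.iterate_succ_apply', Function.iterate_succ_apply']; exact ih.pdRho

lemma EqOm.iterTheta {u v} (h : EqOm u v) (k : ℕ) :
    EqOm (_root_.pdTheta^[k] u) (_root_.pdTheta^[k] v) := by
  induction k with
  | zero => exact h
  | succ k ih => rw [Function.iterate_succ_apply', Function.iterate_succ_apply']; exact ih.pdTheta

lemma EqOm.DD {u v} (h : EqOm u v) (k₁ k₂ : ℕ) : EqOm (DD k₁ k₂ u) (DD k₁ k₂ v) :=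
  (h.iterTheta k₂).iterRho k₁

lemma pdRho_add {u v} (hu : Sm u) (hv : Sm v) :
    EqOm (pdRho (u + v)) (pdRho u + pdRho v) := by
  intro ρ hρ θ
  have := ((hu.hasRho hρ θ).add (hv.hasRho hρ θ)).deriv
  simp only [pdRho, Pi.add_apply]
  rw [(hu.hasRho hρ θ).deriv, (hv.hasRho hρ θ).deriv, ← mul_add, ← this]
  rfl

lemma pdTheta_add {u v} (hu : Sm u) (hv : Sm v) :
    EqOm (pdTheta (u + v)) (pdTheta u + pdTheta v) := by
  intro ρ hρ θ
  have := ((hu.hasTheta hρ θ).add (hv.hasTheta hρ θ)).deriv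
  simp only [pdTheta, Pi.add_apply]
  rw [(hu.hasTheta hρ θ).deriv, (hv.hasTheta hρ θ).deriv, ← this]
  rfl

lemma pdRho_smul {u} (a : ℝ) (hu : Sm u) : EqOm (pdRho (a • u)) (a • pdRho u) := by
  intro ρ hρ θ
  have := ((hu.hasRho hρ θ).const_mul a).deriv
  simp only [pdRho, Pi.smul_apply, smul_eq_mul]
  rw [(hu.hasRho hρ θ).deriv, this]
  ring

lemma pdTheta_smul {u} (a : ℝ) (hu : Sm u) : EqOm (pdTheta (a • u)) (a • pdTheta u) := by
  intro ρ hρ θ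
  have := ((hu.hasTheta hρ θ).const_mul a).deriv
  simp only [pdTheta, Pi.smul_apply, smul_eq_mul]
  rw [(hu.hasTheta hρ θ).deriv, this]

lemma EqOm.add {u v u' v'} (h : EqOm u u') (h' : EqOm v v') : EqOm (u + v) (u' + v') :=
  fun ρ hρ θ => by simp only [Pi.add_apply, h ρ hρ θ, h' ρ hρ θ]

lemma EqOm.smul {u u'} (a : ℝ) (h : EqOm u u') : EqOm (a • u) (a • u') :=
  fun ρ hρ θ => by simp only [Pi.smul_apply, h ρ hρ θ]

lemma iterRho_add {u v} (hu : Sm u) (hv : Sm v) (k : ℕ) :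
    EqOm (pdRho^[k] (u + v)) (pdRho^[k] u + pdRho^[k] v) := by
  induction k with
  | zero => exact EqOm.refl _
  | succ k ih =>
    simp only [Function.iterate_succ_apply']
    exact ih.pdRho.trans (pdRho_add (hu.iterRho k) (hv.iterRho k))

lemma iterTheta_add {u v} (hu : Sm u) (hv : Sm v) (k : ℕ) :
    EqOm (pdTheta^[k] (u + v)) (pdTheta^[k] u + pdTheta^[k] v) := by
  induction k with
  | zero => exact EqOm.refl _
  | succ k ih =>
    simp only [Function.iterate_succ_apply']
    exact ih.pdTheta.trans (pdTheta_add (hu.iterTheta k) (hv.iterTheta k))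

lemma iterRho_smul {u} (a : ℝ) (hu : Sm u) (k : ℕ) :
    EqOm (pdRho^[k] (a • u)) (a • pdRho^[k] u) := by
  induction k with
  | zero => exact EqOm.refl _
  | succ k ih =>
    simp only [Function.iterate_succ_apply']
    exact ih.pdRho.trans (pdRho_smul a (hu.iterRho k))

lemma iterTheta_smul {u} (a : ℝ) (hu : Sm u) (k : ℕ) :
    EqOm (pdTheta^[k] (a • u)) (a • pdTheta^[k] u) := by
  induction k with
  | zero => exact EqOm.refl _
  | succ k ih =>
    simp only [Function.iterate_succ_apply']
    exact ih.pdTheta.trans (pdTheta_smul a (hu.iterTheta k))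

lemma DD_add {u v} (hu : Sm u) (hv : Sm v) (k₁ k₂ : ℕ) :
    EqOm (DD k₁ k₂ (u + v)) (DD k₁ k₂ u + DD k₁ k₂ v) :=
  ((iterTheta_add hu hv k₂).iterRho k₁).trans
    (iterRho_add (hu.iterTheta k₂) (hv.iterTheta k₂) k₁)

lemma DD_smul {u} (a : ℝ) (hu : Sm u) (k₁ k₂ : ℕ) :
    EqOm (DD k₁ k₂ (a • u)) (a • DD k₁ k₂ u) :=
  ((iterTheta_smul a hu k₂).iterRho k₁).trans
    (iterRho_smul a (hu.iterTheta k₂) k₁)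

lemma DD_zero (k₁ k₂ : ℕ) : EqOm (DD k₁ k₂ 0) 0 := by
  have := DD_smul (u := 0) 0 Sm.zero k₁ k₂
  simpa using this

lemma DD_sub {u v} (hu : Sm u) (hv : Sm v) (k₁ k₂ : ℕ) :
    EqOm (DD k₁ k₂ (u - v)) (DD k₁ k₂ u - DD k₁ k₂ v) := by
  have e : u - v = u + (-1 : ℝ) • v := by simp [sub_eq_add_neg]
  have e' : DD k₁ k₂ u - DD k₁ k₂ v = DD k₁ k₂ u + (-1 : ℝ) • DD k₁ k₂ v := by
    simp [sub_eq_add_neg]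
  rw [e, e']
  exact (DD_add hu (hv.smul _) k₁ k₂).trans ((EqOm.refl _).add (DD_smul _ hv k₁ k₂))

lemma DD_sum {ι : Type*} (I : Finset ι) (F : ι → ℝ → ℝ → ℝ) (h : ∀ i ∈ I, Sm (F i)) (k₁ k₂ : ℕ) :
    EqOm (DD k₁ k₂ (∑ i ∈ I, F i)) (∑ i ∈ I, DD k₁ k₂ (F i)) := by
  classical
  induction I using Finset.induction_on with
  | empty => exact DD_zero _ _
  | insert a s ha ih =>
    rw [Finset.sum_insert ha, Finset.sum_insert ha]
    have h' : ∀ i ∈ s, Sm (F i) := fun i hi => h i (by simp [hi])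
    exact (DD_add (h a (by simp)) (Sm.sum s F h') k₁ k₂).trans ((EqOm.refl _).add (ih h'))

lemma pdTheta_E (c : ℂ) (s : ℝ) (l : ℤ) : pdTheta (E c s l) = E (Complex.I * l * c) s l := by
  ext ρ θ
  simp only [pdTheta, E]
  have h1 : HasDerivAt (fun t : ℝ => c * Complex.exp (Complex.I * l * (t : ℂ)))
      (c * (Complex.exp (Complex.I * l * (θ : ℂ)) * (Complex.I * l * 1))) θ := by
    apply HasDerivAt.const_mul
    apply HasDerivAt.cexp
    apply HasDerivAt.const_mul
    exact Complex.ofRealCLM.hasDerivAt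
  have h2 := (Complex.reCLM.hasFDerivAt.comp_hasDerivAt θ h1).mul_const (ρ ^ s)
  have h3 := h2.deriv
  simp only [Function.comp_def, Complex.reCLM_apply] at h3
  rw [h3]
  congr 2
  ring

lemma pdRho_E (c : ℂ) (s : ℝ) (l : ℤ) : EqOm (pdRho (E c s l)) (E (s * c) s l) := by
  intro ρ hρ θ
  simp only [pdRho, E]
  rw [((Real.hasDerivAt_rpow_const (Or.inl hρ.1.ne')).const_mul _).deriv, mul_assoc (s:ℂ),
    Complex.re_ofReal_mul]
  have : ρ ^ s = ρ ^ (s - 1) * ρ := by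
    rw [← Real.rpow_add_one hρ.1.ne']; ring_nf
  rw [this]; ring

lemma iterTheta_E (c : ℂ) (s : ℝ) (l : ℤ) (k : ℕ) :
    pdTheta^[k] (E c s l) = E ((Complex.I * l) ^ k * c) s l := by
  induction k with
  | zero => simp
  | succ k ih => rw [Function.iterate_succ_apply', ih, pdTheta_E]; congr 1; ring

lemma iterRho_E (c : ℂ) (s : ℝ) (l : ℤ) (k : ℕ) :
    EqOm (pdRho^[k] (E c s l)) (E ((s : ℂ) ^ k * c) s l) := by
  induction k with
  | zero => simpa using EqOm.refl _
  | succ k ih =>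
    rw [Function.iterate_succ_apply']
    refine (ih.pdRho.trans (pdRho_E _ _ _)).trans ?_
    have : (s : ℂ) * ((s:ℂ) ^ k * c) = (s:ℂ) ^ (k+1) * c := by ring
    rw [this]; exact EqOm.refl _

lemma DD_E (c : ℂ) (s : ℝ) (l : ℤ) (k₁ k₂ : ℕ) :
    EqOm (DD k₁ k₂ (E c s l)) (E ((s : ℂ) ^ k₁ * ((Complex.I * l) ^ k₂ * c)) s l) := by
  rw [DD, iterTheta_E]
  exact iterRho_E _ _ _ _

lemma abs_E_le (c : ℂ) (s : ℝ) (l : ℤ) {ρ : ℝ} (hρ : 0 < ρ) (θ : ℝ) :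
    |E c s l ρ θ| ≤ ‖c‖ * ρ ^ s := by
  have h1 : ‖Complex.exp (Complex.I * l * θ)‖ = 1 := by
    have := Complex.norm_exp_ofReal_mul_I (l * θ)
    rw [← this]; congr 2; push_cast; ring
  rw [E, abs_mul, abs_of_pos (Real.rpow_pos_of_pos hρ s)]
  have := Complex.abs_re_le_norm (c * Complex.exp (Complex.I * l * θ))
  rw [norm_mul, h1, mul_one] at this
  gcongr

/-- periodicity -/
def Per (u : ℝ → ℝ → ℝ) : Prop := ∀ ρ θ : ℝ, u ρ (θ + 2 * π) = u ρ θ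

lemma Per.pdRho {u} (h : Per u) : Per (pdRho u) := by
  intro ρ θ
  simp only [_root_.pdRho, h _ θ]

lemma Per.pdTheta {u} (h : Per u) : Per (pdTheta u) := by
  intro ρ θ
  simp only [_root_.pdTheta]
  rw [← deriv_comp_add_const]
  simp only [h ρ]

lemma Per.iterRho {u} (h : Per u) (k : ℕ) : Per (_root_.pdRho^[k] u) := by
  induction k with
  | zero => exact h
  | succ k ih => rw [Function.iterate_succ_apply']; exact ih.pdRho

lemma Per.iterTheta {u} (h : Per u) (k : ℕ) : Per (_root_.pdTheta^[k] u) := by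
  induction k with
  | zero => exact h
  | succ k ih => rw [Function.iterate_succ_apply']; exact ih.pdTheta

lemma Per.DD {u} (h : Per u) (k₁ k₂ : ℕ) : Per (DD k₁ k₂ u) := (h.iterTheta k₂).iterRho k₁

lemma Per.add {u v} (h : Per u) (h' : Per v) : Per (u + v) :=
  fun ρ θ => by simp only [Pi.add_apply, h ρ θ, h' ρ θ]

lemma Per.sub {u v} (h : Per u) (h' : Per v) : Per (u - v) :=
  fun ρ θ => by simp only [Pi.sub_apply, h ρ θ, h' ρ θ]

lemma Per.sum {ι : Type*} (I : Finset ι) (F : ι → ℝ → ℝ → ℝ) (h : ∀ i ∈ I, Per (F i)) :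
    Per (∑ i ∈ I, F i) := by
  classical
  induction I using Finset.induction_on with
  | empty => intro _ _; rfl
  | insert a s ha ih =>
    rw [Finset.sum_insert ha]
    exact (h a (by simp)).add (ih fun i hi => h i (by simp [hi]))

lemma Per.E (c : ℂ) (s : ℝ) (l : ℤ) : Per (E c s l) := by
  intro ρ θ
  simp only [ConeAux.E]
  congr 3
  rw [Complex.exp_eq_exp_iff_exists_int]
  exact ⟨l, by push_cast; ring⟩

end ConeAux

namespace ConeAux
open MeasureTheory

/-- exponential kernel -/
noncomputable def ek (l : ℤ) (θ : ℝ) : ℂ := Complex.exp (Complex.I * l * θ)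

lemma norm_ek (l : ℤ) (θ : ℝ) : ‖ek l θ‖ = 1 := by
  have := Complex.norm_exp_ofReal_mul_I (l * θ)
  rw [← this, ek]; congr 2; push_cast; ring

lemma cont_ek (l : ℤ) : Continuous (ek l) := by unfold ek; fun_prop

lemma hasDeriv_ek (l : ℤ) (θ : ℝ) : HasDerivAt (ek l) (Complex.I * l * ek l θ) θ := by
  have : HasDerivAt (ek l) (Complex.exp (Complex.I * l * (θ : ℂ)) * (Complex.I * l * 1)) θ := by
    apply HasDerivAt.cexp
    apply HasDerivAt.const_mul
    exact Complex.ofRealCLM.hasDerivAt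
  convert this using 1
  rw [ek]; ring

/-- Fourier coefficients in `θ`. -/
noncomputable def cf (u : ℝ → ℝ → ℝ) (l : ℤ) (ρ : ℝ) : ℂ :=
  (1 / (2 * π) : ℝ) • ∫ θ in (0:ℝ)..(2 * π), ek (-l) θ * (u ρ θ : ℂ)

lemma Sm.contTheta {u} (h : Sm u) {ρ : ℝ} (hρ : ρ ∈ Ioo (0:ℝ) 1) : Continuous (fun θ => u ρ θ) :=
  continuous_iff_continuousAt.2 fun θ => (h.hasTheta hρ θ).continuousAt

lemma Sm.bdd {u} (h : Sm u) {a b : ℝ} (ha : 0 < a) (hb : b < 1) :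
    ∃ B, 0 ≤ B ∧ ∀ ρ ∈ Icc a b, ∀ θ ∈ Icc (0:ℝ) (2 * π), |u ρ θ| ≤ B := by
  have hK : IsCompact (Icc a b ×ˢ Icc (0:ℝ) (2 * π)) := isCompact_Icc.prod isCompact_Icc
  have hc : ContinuousOn (fun p : ℝ × ℝ => u p.1 p.2) (Icc a b ×ˢ Icc (0:ℝ) (2 * π)) :=
    (ContDiffOn.continuousOn h).mono (by
      rintro ⟨x, y⟩ ⟨hx, -⟩
      exact ⟨⟨ha.trans_le hx.1, hx.2.trans_lt hb⟩, mem_univ _⟩)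
  obtain ⟨C, hC⟩ := hK.exists_bound_of_continuousOn hc
  refine ⟨max C 0, le_max_right _ _, fun ρ hρ θ hθ => ?_⟩
  exact (hC (ρ, θ) ⟨hρ, hθ⟩).trans (le_max_left _ _)

lemma norm_cf_le {u} {l : ℤ} {ρ B : ℝ} (h : ∀ θ ∈ Icc (0:ℝ) (2 * π), |u ρ θ| ≤ B) :
    ‖cf u l ρ‖ ≤ B := by
  have hpi : 0 < 2 * π := by positivity
  have := intervalIntegral.norm_integral_le_of_norm_le_const (a := 0) (b := 2 * π) (C := B)
    (f := fun θ => ek (-l) θ * (u ρ θ : ℂ)) (by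
      intro θ hθ
      rw [uIoc_of_le hpi.le] at hθ
      rw [norm_mul, norm_ek, one_mul, Complex.norm_real]
      exact h θ ⟨hθ.1.le, hθ.2⟩)
  rw [cf, norm_smul, Real.norm_of_nonneg (by positivity)]
  rw [sub_zero, abs_of_pos hpi] at this
  calc _ ≤ 1 / (2 * π) * (B * (2 * π)) := by gcongr
    _ = B := by field_simp

lemma hasDeriv_cf {u} (h : Sm u) (l : ℤ) {ρ : ℝ} (hρ : ρ ∈ Ioo (0:ℝ) 1) :
    HasDerivAt (cf u l) ((ρ⁻¹ : ℝ) * cf (pdRho u) l ρ) ρ := by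
  obtain ⟨a, ha, haρ⟩ := exists_between hρ.1
  obtain ⟨b, hb, hbρ⟩ := exists_between hρ.2
  obtain ⟨B, hB0, hB⟩ := h.pdRho.bdd ha hbρ
  have hpi : 0 < 2 * π := by positivity
  have key := (intervalIntegral.hasDerivAt_integral_of_dominated_loc_of_deriv_le (μ := volume)
    (a := 0) (b := 2 * π)
    (F := fun r θ => ek (-l) θ * (u r θ : ℂ))
    (F' := fun r θ => ek (-l) θ * ((r⁻¹ * pdRho u r θ : ℝ) : ℂ)) (x₀ := ρ) (s := Ioo a b)
    (bound := fun _ => a⁻¹ * B)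
    (Ioo_mem_nhds haρ hb) ?_ ?_ ?_ ?_ ?_ ?_).2
  · have := key.const_smul (1 / (2 * π) : ℝ)
    refine HasDerivAt.congr_deriv (f := cf u l) this ?_
    rw [cf, mul_smul_comm]
    congr 1
    rw [← intervalIntegral.integral_const_mul]
    congr 1
    ext θ
    push_cast; ring
  · filter_upwards [isOpen_Ioo.mem_nhds hρ] with r hr
    exact ((cont_ek _).mul (Complex.continuous_ofReal.comp (h.contTheta hr))).aestronglyMeasurable
  · exact ((cont_ek _).mul (Complex.continuous_ofReal.comp (h.contTheta hρ))).intervalIntegrable _ _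
  · exact ((cont_ek _).mul (Complex.continuous_ofReal.comp
      (continuous_const.mul (h.pdRho.contTheta hρ)))).aestronglyMeasurable
  · refine Filter.Eventually.of_forall fun θ hθ r hr => ?_
    rw [uIoc_of_le hpi.le] at hθ
    rw [norm_mul, norm_ek, one_mul, Complex.norm_real, norm_mul, norm_inv]
    have hr0 : 0 < r := ha.trans hr.1
    rw [Real.norm_of_nonneg hr0.le]
    have := hB r ⟨hr.1.le, hr.2.le⟩ θ ⟨hθ.1.le, hθ.2⟩
    have h2 : r⁻¹ ≤ a⁻¹ := inv_anti₀ ha hr.1.le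
    rw [Real.norm_eq_abs]
    gcongr
  · exact intervalIntegrable_const
  · refine Filter.Eventually.of_forall fun θ hθ r hr => ?_
    have := h.hasRho' (ρ := r) ⟨ha.trans hr.1, hr.2.trans hbρ⟩ θ
    exact (this.ofReal_comp).const_mul _

lemma cf_pdTheta {u} (h : Sm u) (hp : Per u) (l : ℤ) {ρ : ℝ} (hρ : ρ ∈ Ioo (0:ℝ) 1) :
    cf (pdTheta u) l ρ = Complex.I * l * cf u l ρ := by
  have key := intervalIntegral.integral_mul_deriv_eq_deriv_mul (a := 0) (b := 2 * π)
    (u := ek (-l)) (v := fun θ => (u ρ θ : ℂ)) (u' := fun θ => Complex.I * (-l : ℤ) * ek (-l) θ)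
    (v' := fun θ => ((pdTheta u ρ θ : ℝ) : ℂ))
    (fun θ _ => hasDeriv_ek _ θ) (fun θ _ => (h.hasTheta' hρ θ).ofReal_comp)
    (Continuous.intervalIntegrable (continuous_const.mul (cont_ek _)) _ _)
    (Continuous.intervalIntegrable (Complex.continuous_ofReal.comp (h.pdTheta.contTheta hρ)) _ _)
  have e1 : ek (-l) (2 * π) = ek (-l) 0 := by
    simp only [ek]
    rw [Complex.exp_eq_exp_iff_exists_int]
    exact ⟨-l, by push_cast; ring⟩
  have e2 : u ρ (2 * π) = u ρ 0 := by simpa using hp ρ 0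
  rw [cf, cf, key, e1, e2, sub_self, zero_sub, mul_smul_comm]
  congr 1
  rw [← intervalIntegral.integral_const_mul, ← intervalIntegral.integral_neg]
  congr 1
  ext θ
  push_cast; ring

lemma cf_congr {u v} (h : EqOm u v) (l : ℤ) {ρ : ℝ} (hρ : ρ ∈ Ioo (0:ℝ) 1) :
    cf u l ρ = cf v l ρ := by
  simp only [cf, h ρ hρ]

lemma cf_add {u v} (hu : Sm u) (hv : Sm v) (l : ℤ) {ρ : ℝ} (hρ : ρ ∈ Ioo (0:ℝ) 1) :
    cf (u + v) l ρ = cf u l ρ + cf v l ρ := by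
  simp only [cf, Pi.add_apply, Complex.ofReal_add, mul_add]
  rw [intervalIntegral.integral_add, smul_add]
  · exact ((cont_ek _).mul (Complex.continuous_ofReal.comp (hu.contTheta hρ))).intervalIntegrable _ _
  · exact ((cont_ek _).mul (Complex.continuous_ofReal.comp (hv.contTheta hρ))).intervalIntegrable _ _

lemma cf_smul {u} (a : ℝ) (l : ℤ) {ρ : ℝ} :
    cf (a • u) l ρ = a * cf u l ρ := by
  simp only [cf, Pi.smul_apply, smul_eq_mul, Complex.ofReal_mul]
  rw [mul_smul_comm, ← intervalIntegral.integral_const_mul]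
  congr 2
  ext θ; ring

lemma cf_DD {u} (h : Sm u) (hp : Per u) (l : ℤ) (k n : ℕ) :
    ∀ ρ ∈ Ioo (0:ℝ) 1, cf (DD k n u) l ρ = (Complex.I * l) ^ n * cf (DD k 0 u) l ρ := by
  induction k with
  | zero =>
    induction n with
    | zero => simp
    | succ n ih =>
      intro ρ hρ
      have : DD 0 (n+1) u = pdTheta (DD 0 n u) := by
        simp only [DD, Function.iterate_succ_apply', Function.iterate_zero, id]
      rw [this, cf_pdTheta (h.DD 0 n) (hp.DD 0 n) l hρ, ih ρ hρ]; ring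
  | succ k ih =>
    intro ρ hρ
    have e : ∀ n, DD (k+1) n u = pdRho (DD k n u) := fun n => by
      simp only [DD, Function.iterate_succ_apply']
    have h1 := hasDeriv_cf (h.DD k n) l hρ
    have h2 := (hasDeriv_cf (h.DD k 0) l hρ).const_mul ((Complex.I * l) ^ n)
    have h3 := h1.congr_of_eventuallyEq
      (f₁ := fun ρ => (Complex.I * l) ^ n * cf (DD k 0 u) l ρ) (by
        filter_upwards [isOpen_Ioo.mem_nhds hρ] with r hr using (ih r hr).symm)
    have h4 := h3.unique h2
    rw [e, e]
    have hne : ((ρ⁻¹ : ℝ) : ℂ) ≠ 0 := by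
      simpa using hρ.1.ne'
    apply mul_left_cancel₀ hne
    rw [h4]; ring

lemma summ_int : Summable (fun l : ℤ => (1 + (l:ℝ)^2)⁻¹) := by
  have h : Summable (fun n : ℕ => (1 + (n:ℝ)^2)⁻¹) := by
    have h0 : Summable (fun n : ℕ => 1 / (n:ℝ)^2) := Real.summable_one_div_nat_pow.2 (by norm_num)
    rw [← summable_nat_add_iff 1] at h0 ⊢
    refine Summable.of_nonneg_of_le (fun n => by positivity) (fun n => ?_) h0
    rw [one_div]
    apply inv_anti₀ (by positivity)
    linarith
  exact Summable.of_nat_of_neg (by simpa using h) (by simpa using h)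

lemma hasSum_cf {u} (h : Sm u) (hp : Per u) {ρ : ℝ} (hρ : ρ ∈ Ioo (0:ℝ) 1) (θ : ℝ) :
    HasSum (fun l : ℤ => cf u l ρ * ek l θ) (u ρ θ : ℂ) := by
  have hpi : 0 < 2 * π := by positivity
  have : Fact (0 < 2 * π) := ⟨hpi⟩
  have hper : Function.Periodic (fun t => (u ρ t : ℂ)) (2 * π) := fun t => by simp only [hp ρ t]
  have hcont : Continuous hper.lift :=
    continuous_quot_lift _ (Complex.continuous_ofReal.comp (h.contTheta hρ))
  let F : C(AddCircle (2 * π), ℂ) := ⟨hper.lift, hcont⟩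
  have hek : ∀ (l : ℤ) (t : ℝ), fourier l (t : AddCircle (2 * π)) = ek l t := by
    intro l t
    rw [fourier_coe_apply, ek]
    congr 1
    have : (π : ℂ) ≠ 0 := by exact_mod_cast Real.pi_ne_zero
    push_cast
    field_simp
  have hco : ∀ l, fourierCoeff F l = cf u l ρ := by
    intro l
    rw [fourierCoeff_eq_intervalIntegral _ _ 0, cf, zero_add]
    congr 1
    congr 1
    ext t
    rw [hek, smul_eq_mul]
    rfl
  have hs : Summable (fourierCoeff F) := by
    obtain ⟨B, hB0, hB⟩ := h.bdd hρ.1 hρ.2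
    obtain ⟨B', hB0', hB'⟩ := (h.DD 0 2).bdd hρ.1 hρ.2
    refine Summable.of_norm_bounded (summ_int.mul_left (B + B')) fun l => ?_
    rw [hco]
    have h1 : ‖cf u l ρ‖ ≤ B := norm_cf_le (hB ρ ⟨le_rfl, le_rfl⟩)
    have h2 : ‖cf (DD 0 2 u) l ρ‖ ≤ B' := norm_cf_le (hB' ρ ⟨le_rfl, le_rfl⟩)
    rw [cf_DD h hp l 0 2 ρ hρ] at h2
    have e : DD 0 0 u = u := rfl
    rw [e, norm_mul, norm_pow, norm_mul, Complex.norm_I, one_mul, Complex.norm_intCast,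
      sq_abs] at h2
    rw [← div_eq_mul_inv, le_div_iff₀ (by positivity)]
    linarith
  have := has_pointwise_sum_fourier_series_of_summable hs (θ : AddCircle (2 * π))
  simp only [hco, hek, smul_eq_mul] at this
  exact this

end ConeAux

namespace ConeAux
open Filter Topology

lemma mvt {F F' : ℝ → ℂ} {B B' : ℝ → ℝ} {x y : ℝ} (hxy : x ≤ y)
    (hF : ∀ t ∈ Icc x y, HasDerivAt F (F' t) t) (hB : ∀ t ∈ Icc x y, HasDerivAt B (B' t) t)
    (hb : ∀ t ∈ Icc x y, ‖F' t‖ ≤ B' t) : ‖F y - F x‖ ≤ B y - B x := by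
  have := image_norm_le_of_norm_deriv_right_le_deriv_boundary' (a := x) (b := y)
    (f := fun t => F t - F x) (f' := F') (B := fun t => B t - B x) (B' := B')
    (fun t ht => ((hF t ht).continuousAt.sub continuousAt_const).continuousWithinAt)
    (fun t ht => ((hF t ⟨ht.1, ht.2.le⟩).sub_const _).hasDerivWithinAt)
    (by simp)
    (fun t ht => ((hB t ht).continuousAt.sub continuousAt_const).continuousWithinAt)
    (fun t ht => ((hB t ⟨ht.1, ht.2.le⟩).sub_const _).hasDerivWithinAt)
    (fun t ht => hb t ⟨ht.1, ht.2.le⟩)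
  exact this (right_mem_Icc.2 hxy)

lemma L0 {F F' : ℝ → ℂ} {R K a : ℝ} (ha : a ≠ 0)
    (hF : ∀ t ∈ Ioo 0 R, HasDerivAt F (F' t) t)
    (hb : ∀ t ∈ Ioo 0 R, ‖F' t‖ ≤ K * t ^ (a - 1)) {x y : ℝ} (hx : 0 < x) (hxy : x ≤ y)
    (hy : y < R) : ‖F y - F x‖ ≤ K / a * y ^ a - K / a * x ^ a := by
  have hm : ∀ t ∈ Icc x y, t ∈ Ioo 0 R := fun t ht => ⟨hx.trans_le ht.1, ht.2.trans_lt hy⟩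
  refine mvt (F' := F') (B := fun t => K / a * t ^ a) (B' := fun t => K * t ^ (a - 1)) hxy
    (fun t ht => hF t (hm t ht)) (fun t ht => ?_) (fun t ht => hb t (hm t ht))
  have := (Real.hasDerivAt_rpow_const (p := a) (Or.inl (hm t ht).1.ne')).const_mul (K / a)
  refine this.congr_deriv ?_
  field_simp

lemma L1 {F F' : ℝ → ℂ} {R K a : ℝ} (hR : 0 < R) (hK : 0 ≤ K) (ha : 0 < a)
    (hF : ∀ t ∈ Ioo 0 R, HasDerivAt F (F' t) t)
    (hb : ∀ t ∈ Ioo 0 R, ‖F' t‖ ≤ K * t ^ (a - 1)) :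
    ∃ A : ℂ, ∀ t ∈ Ioo 0 R, ‖F t - A‖ ≤ K / a * t ^ a := by
  have h0 : ∀ x y, 0 < x → x ≤ y → y < R → ‖F y - F x‖ ≤ K / a * y ^ a := by
    intro x y hx hxy hy
    have := L0 ha.ne' hF hb hx hxy hy
    have h2 : 0 ≤ K / a * x ^ a := by positivity
    linarith
  let s : ℕ → ℝ := fun n => R * (1 / ((n + 1 : ℕ) + 1 : ℝ))
  have hs : ∀ n, s n ∈ Ioo 0 R := fun n => by
    refine ⟨by positivity, ?_⟩
    have : (1 / ((n + 1 : ℕ) + 1 : ℝ)) < 1 := by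
      rw [div_lt_one (by positivity)]; push_cast; linarith [(Nat.cast_nonneg n : (0:ℝ) ≤ n)]
    calc s n < R * 1 := mul_lt_mul_of_pos_left this hR
      _ = R := mul_one R
  have hanti : ∀ m n, m ≤ n → s n ≤ s m := fun m n h => by
    have : (m : ℝ) ≤ n := by exact_mod_cast h
    simp only [s]; push_cast
    gcongr
  have hlim : Tendsto s atTop (𝓝 0) := by
    have := (tendsto_one_div_add_atTop_nhds_zero_nat (𝕜 := ℝ)).comp (tendsto_add_atTop_nat 1)
    simpa [s] using this.const_mul R
  have hlim2 : Tendsto (fun n => K / a * (s n) ^ a) atTop (𝓝 0) := by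
    have := (hlim.rpow_const (p := a) (Or.inr ha.le)).const_mul (K / a)
    simpa [Real.zero_rpow ha.ne'] using this
  have hc : CauchySeq (fun n => F (s n)) := by
    refine cauchySeq_of_le_tendsto_0' (fun n => K / a * (s n) ^ a) ?_ hlim2
    intro n m hnm
    rw [dist_eq_norm]
    exact h0 _ _ (hs m).1 (hanti _ _ hnm) (hs n).2
  obtain ⟨A, hA⟩ := cauchySeq_tendsto_of_complete hc
  refine ⟨A, fun t ht => ?_⟩
  refine le_of_tendsto ((tendsto_const_nhds.sub hA).norm) ?_
  filter_upwards [hlim.eventually (gt_mem_nhds ht.1)] with n hn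
  exact h0 _ _ (hs n).1 hn.le ht.2

lemma L2 {v V : ℝ → ℂ} {R M : ℝ} {A : ℂ} (hR : 0 < R)
    (hv : ∀ t ∈ Ioo 0 R, HasDerivAt v ((t⁻¹ : ℝ) * V t) t) (hM : ∀ t ∈ Ioo 0 R, ‖v t‖ ≤ M)
    (hV : Tendsto V (𝓝[>] 0) (𝓝 A)) : A = 0 := by
  by_contra hA
  have hA' : 0 < ‖A‖ := norm_pos_iff.2 hA
  have h1 := Metric.tendsto_nhds.1 hV (‖A‖ / 2) (by positivity)
  obtain ⟨δ, hδ, hδ'⟩ := mem_nhdsGT_iff_exists_Ioo_subset.1 h1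
  have hδ : 0 < δ := hδ
  set y := min δ R / 2 with hy
  have hmin : 0 < min δ R := lt_min hδ hR
  have hy0 : 0 < y := by positivity
  have hyδ : y < δ := by have := min_le_left δ R; linarith
  have hyR : y < R := by have := min_le_right δ R; linarith
  set T := (2 * M + 1) / (‖A‖ / 2) with hT
  have hM0 : 0 ≤ M := (norm_nonneg _).trans (hM y ⟨hy0, hyR⟩)
  have hT0 : 0 < T := by positivity
  set x := y * Real.exp (-T) with hx
  have hx0 : 0 < x := by positivity
  have hxy : x ≤ y := by
    rw [hx]
    have : Real.exp (-T) ≤ 1 := Real.exp_le_one_iff.2 (by linarith)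
    nlinarith
  have key := mvt (F := fun t => v t - A * (Real.log t : ℝ))
    (F' := fun t => (t⁻¹ : ℝ) * V t - A * (t⁻¹ : ℝ))
    (B := fun t => ‖A‖ / 2 * Real.log t) (B' := fun t => ‖A‖ / 2 * t⁻¹) hxy
    (fun t ht => by
      have ht0 : 0 < t := hx0.trans_le ht.1
      exact (hv t ⟨ht0, ht.2.trans_lt hyR⟩).sub
        ((Real.hasDerivAt_log ht0.ne').ofReal_comp.const_mul A))
    (fun t ht => (Real.hasDerivAt_log (hx0.trans_le ht.1).ne').const_mul _)
    (fun t ht => by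
      have ht0 : 0 < t := hx0.trans_le ht.1
      have := hδ' ⟨ht0, ht.2.trans_lt hyδ⟩
      rw [mem_ofPred_eq, dist_eq_norm] at this
      have e : ((t⁻¹ : ℝ) : ℂ) * V t - A * (t⁻¹ : ℝ) = (t⁻¹ : ℝ) * (V t - A) := by ring
      rw [e, norm_mul, Complex.norm_real, Real.norm_of_nonneg (by positivity), mul_comm]
      gcongr)
  have hlog : Real.log x = Real.log y - T := by
    rw [hx, Real.log_mul hy0.ne' (Real.exp_ne_zero _), Real.log_exp]; ring
  simp only [hlog] at key
  have e : v y - A * (Real.log y : ℝ) - (v x - A * ((Real.log y - T : ℝ) : ℂ))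
      = (v y - v x) - A * T := by push_cast; ring
  rw [e] at key
  have h2 : ‖A * (T : ℂ)‖ ≤ ‖(v y - v x) - A * T‖ + ‖v y - v x‖ := by
    have := norm_sub_le (v y - v x) ((v y - v x) - A * T)
    rw [sub_sub_cancel] at this; linarith
  have h3 := norm_sub_le (v y) (v x)
  have h4 := hM y ⟨hy0, hyR⟩
  have h5 := hM x ⟨hx0, hxy.trans_lt hyR⟩
  rw [norm_mul, Complex.norm_real, Real.norm_of_nonneg hT0.le] at h2
  have h6 : ‖A‖ / 2 * T = 2 * M + 1 := by rw [hT]; field_simp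
  nlinarith

/-- hypotheses of the radial ODE on `(0, 1/2)` -/
structure ODE (m p K M : ℝ) (h h1 G : ℝ → ℂ) : Prop where
  dh : ∀ t ∈ Ioo (0:ℝ) (1/2), HasDerivAt h ((t⁻¹ : ℝ) * h1 t) t
  dh1 : ∀ t ∈ Ioo (0:ℝ) (1/2), HasDerivAt h1 ((t⁻¹ : ℝ) * ((m:ℂ) ^ 2 * h t + G t)) t
  G : ∀ t ∈ Ioo (0:ℝ) (1/2), ‖G t‖ ≤ K * t ^ p
  M : ∀ t ∈ Ioo (0:ℝ) (1/2), ‖h t‖ ≤ M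

lemma hasDeriv_rpowC {m t : ℝ} (ht : 0 < t) :
    HasDerivAt (fun t : ℝ => ((t ^ m : ℝ) : ℂ)) ((t⁻¹ : ℝ) * (m * (t ^ m : ℝ))) t := by
  have := (Real.hasDerivAt_rpow_const (p := m) (Or.inl ht.ne')).ofReal_comp
  refine this.congr_deriv ?_
  rw [Real.rpow_sub_one ht.ne']
  push_cast
  have : (t : ℂ) ≠ 0 := by exact_mod_cast ht.ne'
  field_simp

lemma ODE.step1 {m p K M : ℝ} {h h1 G : ℝ → ℂ} (hm : 0 ≤ m) (hp : 0 < p) (hK : 0 ≤ K)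
    (H : ODE m p K M h h1 G) :
    ∀ t ∈ Ioo (0:ℝ) (1/2), ‖h1 t - m * h t‖ ≤ K / (m + p) * t ^ p := by
  have hz : ∀ t ∈ Ioo (0:ℝ) (1/2),
      HasDerivAt (fun t => ((t ^ m : ℝ) : ℂ) * (h1 t - m * h t))
        ((t⁻¹ : ℝ) * ((t ^ m : ℝ) * G t)) t := by
    intro t ht
    have := (hasDeriv_rpowC (m := m) ht.1).mul ((H.dh1 t ht).sub ((H.dh t ht).const_mul (m:ℂ)))
    refine this.congr_deriv ?_
    simp only [Pi.sub_apply]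
    ring
  obtain ⟨A, hA⟩ := L1 (a := m + p) (K := K) (by norm_num) hK (by linarith) hz (by
    intro t ht
    have ht0 := ht.1
    rw [norm_mul, norm_mul, Complex.norm_real, Complex.norm_real,
      Real.norm_of_nonneg (by positivity), Real.norm_of_nonneg (by positivity)]
    have := H.G t ht
    rw [Real.rpow_sub_one ht0.ne', Real.rpow_add ht0]
    calc t⁻¹ * (t ^ m * ‖G t‖) ≤ t⁻¹ * (t ^ m * (K * t ^ p)) := by gcongr
      _ = _ := by field_simp)
  have hA0 : A = 0 := by
    refine L2 (v := fun t => ((t ^ m : ℝ) : ℂ) * h t)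
      (V := fun t => ((t ^ m : ℝ) : ℂ) * (h1 t - m * h t) + 2 * m * (((t ^ m : ℝ) : ℂ) * h t))
      (R := 1/2) (M := M) (by norm_num) ?_ ?_ ?_
    · intro t ht
      refine ((hasDeriv_rpowC (m := m) ht.1).mul (H.dh t ht)).congr_deriv ?_
      ring
    · intro t ht
      have ht0 := ht.1
      rw [norm_mul, Complex.norm_real, Real.norm_of_nonneg (by positivity)]
      have h1 : t ^ m ≤ 1 := Real.rpow_le_one ht0.le (by linarith [ht.2]) hm
      have h2 := H.M t ht
      have h3 := norm_nonneg (h t)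
      nlinarith
    · have hI : Ioo (0:ℝ) (1/2) ∈ 𝓝[>] (0:ℝ) := Ioo_mem_nhdsGT (by norm_num)
      have hpow : ∀ a : ℝ, 0 < a → Tendsto (fun t : ℝ => t ^ a) (𝓝[>] 0) (𝓝 0) := by
        intro a ha
        have : Tendsto (fun t : ℝ => t ^ a) (𝓝 0) (𝓝 (0 ^ a)) :=
          (Real.continuousAt_rpow_const 0 a (Or.inr ha.le))
        rw [Real.zero_rpow ha.ne'] at this
        exact this.mono_left nhdsWithin_le_nhds
      have t1 : Tendsto (fun t => ((t ^ m : ℝ) : ℂ) * (h1 t - m * h t)) (𝓝[>] 0) (𝓝 A) := by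
        rw [tendsto_iff_norm_sub_tendsto_zero]
        refine squeeze_zero' (Eventually.of_forall fun t => norm_nonneg _)
          (g := fun t => K / (m + p) * t ^ (m + p)) ?_ ?_
        · filter_upwards [hI] with t ht using hA t ht
        · simpa using (hpow (m + p) (by linarith)).const_mul (K / (m + p))
      have t2 : Tendsto (fun t => 2 * (m:ℂ) * (((t ^ m : ℝ) : ℂ) * h t)) (𝓝[>] 0) (𝓝 0) := by
        rcases hm.eq_or_lt with hm0 | hm0
        · subst hm0; simp
        · rw [tendsto_zero_iff_norm_tendsto_zero]
          refine squeeze_zero' (Eventually.of_forall fun t => norm_nonneg _)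
            (g := fun t => 2 * m * M * t ^ m) ?_ ?_
          · filter_upwards [hI] with t ht
            have ht0 := ht.1
            rw [norm_mul, norm_mul, norm_mul, Complex.norm_real, Complex.norm_real,
              Real.norm_of_nonneg (by positivity : 0 ≤ t ^ m), Real.norm_of_nonneg hm]
            have h2 := H.M t ht
            simp only [Complex.norm_ofNat]
            calc 2 * m * (t ^ m * ‖h t‖) ≤ 2 * m * (t ^ m * M) := by gcongr
              _ = _ := by ring
          · simpa using (hpow m hm0).const_mul (2 * m * M)
      simpa using t1.add t2
  intro t ht
  have ht0 := ht.1
  have := hA t ht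
  rw [hA0, sub_zero, norm_mul, Complex.norm_real, Real.norm_of_nonneg (by positivity),
    Real.rpow_add ht0] at this
  have hpos : 0 < t ^ m := by positivity
  refine le_of_mul_le_mul_left ?_ hpos
  linarith

lemma ODE.step2 {m p K M : ℝ} {h h1 G : ℝ → ℂ} (hm : 0 ≤ m) (hp : 0 < p) (hK : 0 ≤ K)
    (H : ODE m p K M h h1 G) :
    (∀ t ∈ Ioo (0:ℝ) (1/2), HasDerivAt (fun t => ((t ^ (-m) : ℝ) : ℂ) * h t)
      ((t⁻¹ : ℝ) * ((t ^ (-m) : ℝ) * (h1 t - m * h t))) t) ∧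
    ∀ t ∈ Ioo (0:ℝ) (1/2), ‖((t⁻¹ : ℝ) : ℂ) * ((t ^ (-m) : ℝ) * (h1 t - m * h t))‖ ≤
      K / (m + p) * t ^ ((p - m) - 1) := by
  refine ⟨fun t ht => ?_, fun t ht => ?_⟩
  · refine ((hasDeriv_rpowC (m := -m) ht.1).mul (H.dh t ht)).congr_deriv ?_
    push_cast; ring
  · have ht0 := ht.1
    have := H.step1 hm hp hK t ht
    rw [norm_mul, norm_mul, Complex.norm_real, Complex.norm_real,
      Real.norm_of_nonneg (by positivity), Real.norm_of_nonneg (by positivity),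
      Real.rpow_sub_one ht0.ne', sub_eq_add_neg p m, Real.rpow_add ht0]
    calc t⁻¹ * (t ^ (-m) * ‖h1 t - m * h t‖)
        ≤ t⁻¹ * (t ^ (-m) * (K / (m + p) * t ^ p)) := by gcongr
      _ = _ := by field_simp

lemma ODE.low {m p K M : ℝ} {h h1 G : ℝ → ℂ} (hm : 0 ≤ m) (hp : 0 < p) (hK : 0 ≤ K)
    (hmp : m < p) (H : ODE m p K M h h1 G) :
    ∃ (c : ℂ) (C : ℝ), ∀ t ∈ Ioo (0:ℝ) (1/2), ‖h t - c * (t ^ m : ℝ)‖ ≤ C * t ^ p ∧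
      ‖h1 t - m * c * (t ^ m : ℝ)‖ ≤ C * t ^ p := by
  obtain ⟨s1, s2⟩ := H.step2 hm hp hK
  obtain ⟨c, hc⟩ := L1 (a := p - m) (K := K / (m + p)) (by norm_num) (by positivity)
    (by linarith) s1 s2
  set C := K / (m + p) / (p - m) with hC
  have hpm : 0 < p - m := by linarith
  have hC0 : 0 ≤ C := by positivity
  have a1 : ∀ t ∈ Ioo (0:ℝ) (1/2), ‖h t - c * (t ^ m : ℝ)‖ ≤ C * t ^ p := by
    intro t ht
    have ht0 := ht.1
    have h2 := hc t ht
    have hpos : 0 < t ^ m := by positivity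
    have e : h t - c * (t ^ m : ℝ) = (t ^ m : ℝ) * (((t ^ (-m) : ℝ) : ℂ) * h t - c) := by
      rw [Real.rpow_neg ht0.le]
      have : ((t ^ m : ℝ) : ℂ) ≠ 0 := by exact_mod_cast hpos.ne'
      push_cast
      field_simp
    rw [e, norm_mul, Complex.norm_real, Real.norm_of_nonneg hpos.le]
    calc _ ≤ t ^ m * (C * t ^ (p - m)) := by gcongr
      _ = _ := by rw [Real.rpow_sub ht0]; field_simp
  refine ⟨c, m * C + C + K / (m + p), fun t ht => ⟨?_, ?_⟩⟩
  · have ht0 := ht.1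
    have hpos : 0 < t ^ p := by positivity
    have h1 : 0 ≤ m * C + K / (m + p) := by positivity
    have := a1 t ht
    nlinarith
  · have ht0 := ht.1
    have hpos : 0 < t ^ p := by positivity
    have e : h1 t - m * c * (t ^ m : ℝ) = (h1 t - m * h t) + m * (h t - c * (t ^ m : ℝ)) := by ring
    rw [e]
    have b1 := H.step1 hm hp hK t ht
    have b2 := a1 t ht
    have b3 := norm_add_le (h1 t - m * h t) (m * (h t - c * (t ^ m : ℝ)))
    rw [norm_mul (m:ℂ), Complex.norm_real, Real.norm_of_nonneg hm] at b3
    have b4 : m * ‖h t - c * (t ^ m : ℝ)‖ ≤ m * (C * t ^ p) := by gcongr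
    have b5 : 0 ≤ C * t ^ p := by positivity
    nlinarith

lemma ODE.high {m p K M B : ℝ} {h h1 G : ℝ → ℂ} (hm : 0 ≤ m) (hp : 0 < p) (hK : 0 ≤ K)
    (hmp : p < m) (H : ODE m p K M h h1 G) (hB0 : 0 ≤ B) (hB : ∀ t ∈ Ico (1/4 : ℝ) (1/2), ‖h t‖ ≤ B) :
    ∀ t ∈ Ioo (0:ℝ) (1/2), ‖h t‖ ≤ (B * 4 ^ p + K / (m + p) / (m - p)) * t ^ p := by
  obtain ⟨s1, s2⟩ := H.step2 hm hp hK
  have hpm : 0 < m - p := by linarith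
  have hC0 : 0 ≤ K / (m + p) / (m - p) := by positivity
  set C := K / (m + p) / (m - p) with hC
  intro t ht
  have ht0 := ht.1
  have hpp : 0 < t ^ p := by positivity
  rcases le_or_gt (1/4) t with h4 | h4
  · have e1 : 1 ≤ (4:ℝ) ^ p * t ^ p := by
      rw [← Real.mul_rpow (by norm_num) ht0.le]
      exact Real.one_le_rpow (by linarith) hp.le
    have e2 := hB t ⟨h4, ht.2⟩
    have e3 : 0 ≤ C * t ^ p := by positivity
    nlinarith
  · have key := L0 (a := p - m) (K := K / (m + p)) (by linarith) s1 s2 ht0 h4.le (by norm_num)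
    have ec : K / (m + p) / (p - m) = -C := by
      rw [hC, ← neg_sub m p, div_neg]
    rw [ec] at key
    have hpos : 0 < t ^ m := by positivity
    have h14 : (0:ℝ) ≤ C * (1/4) ^ (p - m) := by positivity
    have k2 : ‖((t ^ (-m) : ℝ) : ℂ) * h t‖ ≤
        C * t ^ (p - m) + ‖(((1/4) ^ (-m) : ℝ) : ℂ) * h (1/4)‖ := by
      have := norm_sub_le ((((1/4) ^ (-m) : ℝ) : ℂ) * h (1/4))
        ((((1/4) ^ (-m) : ℝ) : ℂ) * h (1/4) - ((t ^ (-m) : ℝ) : ℂ) * h t)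
      rw [sub_sub_cancel] at this
      linarith
    rw [norm_mul, norm_mul, Complex.norm_real, Complex.norm_real,
      Real.norm_of_nonneg (by positivity), Real.norm_of_nonneg (by positivity)] at k2
    have b := hB (1/4) ⟨le_rfl, by norm_num⟩
    have e4 : ((1:ℝ)/4) ^ (-m) = 4 ^ m := by
      rw [Real.rpow_neg (by norm_num), ← Real.inv_rpow (by norm_num)]; norm_num
    rw [e4] at k2
    have k3 : ‖h t‖ ≤ C * t ^ p + (4 ^ m * t ^ m) * B := by
      have e5 : ‖h t‖ = t ^ m * (t ^ (-m) * ‖h t‖) := by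
        rw [← mul_assoc, ← Real.rpow_add ht0]; simp
      rw [e5]
      calc t ^ m * (t ^ (-m) * ‖h t‖) ≤ t ^ m * (C * t ^ (p - m) + 4 ^ m * B) := by
            gcongr
            refine k2.trans ?_
            gcongr
        _ = C * (t ^ m * t ^ (p - m)) + (4 ^ m * t ^ m) * B := by ring
        _ = _ := by rw [← Real.rpow_add ht0]; ring_nf
    have k4 : (4:ℝ) ^ m * t ^ m ≤ 4 ^ p * t ^ p := by
      rw [← Real.mul_rpow (by norm_num) ht0.le, ← Real.mul_rpow (by norm_num) ht0.le]
      exact Real.rpow_le_rpow_of_exponent_ge (by positivity) (by linarith) hmp.le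
    nlinarith

end ConeAux

namespace ConeAux

lemma norm_Il (l : ℤ) (n : ℕ) : ‖(Complex.I * l) ^ n‖ = (l.natAbs : ℝ) ^ n := by
  rw [norm_pow, norm_mul, Complex.norm_I, one_mul, Complex.norm_intCast, Nat.cast_natAbs]
  push_cast; rfl

lemma sq_natAbs (l : ℤ) : ((l.natAbs : ℝ)) ^ 2 = (l:ℝ) ^ 2 := by
  rw [Nat.cast_natAbs]; push_cast; exact sq_abs _

lemma cf_bound {p : ℝ} {g} (hg : Sm g) (gp : Per g) (hO : Otilde p g) (k n : ℕ) :
    ∃ C : ℝ, 0 ≤ C ∧ ∀ l : ℤ, ∀ t ∈ Ioo (0:ℝ) (1/2),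
      (l.natAbs : ℝ) ^ n * ‖cf (DD k 0 g) l t‖ ≤ C * t ^ p := by
  obtain ⟨C, hC⟩ := hO k n
  refine ⟨|C|, abs_nonneg _, fun l t ht => ?_⟩
  have ht1 : t ∈ Ioo (0:ℝ) 1 := ⟨ht.1, by linarith [ht.2]⟩
  rw [← norm_Il, ← norm_mul, ← cf_DD hg gp l k n t ht1]
  apply norm_cf_le
  intro θ _
  have ht0 := ht.1
  refine (hC t θ ht.1 ht.2).trans ?_
  gcongr
  exact le_abs_self C

lemma cf_rec {γ : ℝ} {w g} (hw : Sm w) (hg : Sm g) (wp : Per w)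
    (heq : EqOm (pdRho (pdRho w) + γ ^ 2 • pdTheta (pdTheta w)) g) (k : ℕ) (l : ℤ)
    {ρ : ℝ} (hρ : ρ ∈ Ioo (0:ℝ) 1) :
    cf (DD (k+2) 0 w) l ρ =
      ((γ * l.natAbs : ℝ) : ℂ) ^ 2 * cf (DD k 0 w) l ρ + cf (DD k 0 g) l ρ := by
  have e1 : EqOm (DD 2 0 w) (g + (-(γ ^ 2)) • DD 0 2 w) := by
    intro ρ hρ θ
    have := heq ρ hρ θ
    simp only [Pi.add_apply, Pi.smul_apply, smul_eq_mul] at this ⊢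
    have a1 : DD 2 0 w = pdRho (pdRho w) := rfl
    have a2 : DD 0 2 w = pdTheta (pdTheta w) := rfl
    rw [a1, a2]
    linarith
  have e2 := (e1.DD k 0).trans (DD_add hg ((hw.DD 0 2).smul _) k 0)
  have e3 : EqOm (DD k 0 ((-(γ ^ 2)) • DD 0 2 w)) ((-(γ ^ 2)) • DD k 2 w) :=
    DD_smul _ (hw.DD 0 2) k 0
  have e4 := e2.trans ((EqOm.refl _).add e3)
  have e5 : DD k 0 (DD 2 0 w) = DD (k+2) 0 w := by
    simp only [DD, Function.iterate_add_apply, Function.iterate_zero, id]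
  rw [e5] at e4
  rw [cf_congr e4 l hρ, cf_add (hg.DD k 0) ((hw.DD k 2).smul _) l hρ, cf_smul,
    cf_DD hw wp l k 2 ρ hρ]
  have h6 : ((l.natAbs : ℝ) : ℂ) ^ 2 = (l : ℂ) ^ 2 := by exact_mod_cast sq_natAbs l
  push_cast
  push_cast at h6
  rw [mul_pow, mul_pow, Complex.I_sq, h6]
  ring

lemma mkODE {γ p : ℝ} {w g} (hw : Sm w) (hg : Sm g) (wp : Per w) (gp : Per g)
    (heq : EqOm (pdRho (pdRho w) + γ ^ 2 • pdTheta (pdTheta w)) g) {M K : ℝ}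
    (hM : ∀ ρ ∈ Ioo (0:ℝ) (1/2), ∀ θ, |w ρ θ| ≤ M) (N : ℕ) (l : ℤ)
    (hK : ∀ t ∈ Ioo (0:ℝ) (1/2), (l.natAbs : ℝ) ^ N * ‖cf (DD 0 0 g) l t‖ ≤ K * t ^ p) :
    ODE (γ * l.natAbs) p K ((l.natAbs : ℝ) ^ N * M) (cf (DD 0 N w) l) (cf (DD 1 N w) l)
      (cf (DD 0 N g) l) := by
  have h1 : ∀ t ∈ Ioo (0:ℝ) (1/2), t ∈ Ioo (0:ℝ) 1 := fun t ht => ⟨ht.1, by linarith [ht.2]⟩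
  refine ⟨fun t ht => ?_, fun t ht => ?_, fun t ht => ?_, fun t ht => ?_⟩
  · exact hasDeriv_cf (hw.DD 0 N) l (h1 t ht)
  · refine (hasDeriv_cf (hw.DD 1 N) l (h1 t ht)).congr_deriv ?_
    congr 1
    have e : pdRho (DD 1 N w) = DD 2 N w := rfl
    rw [e, cf_DD hw wp l 2 N t (h1 t ht), cf_DD hw wp l 0 N t (h1 t ht),
      cf_DD hg gp l 0 N t (h1 t ht), cf_rec hw hg wp heq 0 l (h1 t ht)]
    ring
  · rw [cf_DD hg gp l 0 N t (h1 t ht), norm_mul, norm_Il]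
    exact hK t ht
  · rw [cf_DD hw wp l 0 N t (h1 t ht), norm_mul, norm_Il]
    gcongr
    exact norm_cf_le fun θ _ => hM t ht θ

lemma gap {γ : ℝ} (hγ : 0 < γ) (p : ℝ) :
    ∃ δ : ℝ, 0 < δ ∧ ∀ n : ℕ, p < γ * n → δ ≤ γ * n - p := by
  refine ⟨γ * (⌊p / γ⌋ + 1 : ℤ) - p, ?_, ?_⟩
  · have := Int.lt_floor_add_one (p / γ)
    rw [div_lt_iff₀ hγ] at this
    push_cast; linarith
  · intro n hn
    have h1 : p / γ < n := by rw [div_lt_iff₀ hγ]; linarith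
    have h2 : ⌊p / γ⌋ < (n : ℤ) := Int.floor_lt.2 (by exact_mod_cast h1)
    have h3 : ((⌊p / γ⌋ + 1 : ℤ) : ℝ) ≤ n := by exact_mod_cast h2
    have : γ * ((⌊p / γ⌋ + 1 : ℤ) : ℝ) ≤ γ * n := by gcongr
    linarith

lemma high {γ p : ℝ} (hγ : 0 < γ) (hp : 0 < p) {w g}
    (hw : Sm w) (hg : Sm g) (wp : Per w) (gp : Per g)
    (heq : EqOm (pdRho (pdRho w) + γ ^ 2 • pdTheta (pdTheta w)) g) {M : ℝ}
    (hM : ∀ ρ ∈ Ioo (0:ℝ) (1/2), ∀ θ, |w ρ θ| ≤ M) (hO : Otilde p g) (N : ℕ) :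
    ∃ C : ℝ, 0 ≤ C ∧ ∀ l : ℤ, p < γ * l.natAbs → ∀ t ∈ Ioo (0:ℝ) (1/2),
      (l.natAbs : ℝ) ^ N * ‖cf (DD 0 0 w) l t‖ ≤ C * t ^ p ∧
      (l.natAbs : ℝ) ^ N * ‖cf (DD 1 0 w) l t‖ ≤ C * t ^ p := by
  obtain ⟨δ, hδ, hgap⟩ := gap hγ p
  have h1 : ∀ t ∈ Ioo (0:ℝ) (1/2), t ∈ Ioo (0:ℝ) 1 := fun t ht => ⟨ht.1, by linarith [ht.2]⟩
  have A : ∀ N : ℕ, ∃ C : ℝ, 0 ≤ C ∧ ∀ l : ℤ, p < γ * l.natAbs → ∀ t ∈ Ioo (0:ℝ) (1/2),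
      (l.natAbs : ℝ) ^ N * ‖cf (DD 0 0 w) l t‖ ≤ C * t ^ p := by
    intro N
    obtain ⟨K, hK0, hK⟩ := cf_bound hg gp hO 0 N
    obtain ⟨B, hB0, hB⟩ := (hw.DD 0 N).bdd (a := 1/4) (b := 1/2) (by norm_num) (by norm_num)
    refine ⟨B * 4 ^ p + K / p / δ, by positivity, fun l hl t ht => ?_⟩
    have H := mkODE hw hg wp gp heq hM N l (hK l)
    have := H.high (by positivity) hp hK0 hl hB0
      (fun t ht => norm_cf_le fun θ hθ => hB t ⟨ht.1, ht.2.le⟩ θ hθ) t ht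
    rw [cf_DD hw wp l 0 N t (h1 t ht), norm_mul, norm_Il] at this
    refine this.trans ?_
    have ht0 := ht.1
    have h2 := hgap _ hl
    have h3 : 0 ≤ γ * l.natAbs := by positivity
    gcongr
    linarith
  obtain ⟨C0, hC0, H0⟩ := A N
  obtain ⟨C1, hC1, H1⟩ := A (N+1)
  obtain ⟨K, hK0, hK⟩ := cf_bound hg gp hO 0 N
  refine ⟨C0 + (K / p + γ * C1), by positivity, fun l hl t ht => ⟨?_, ?_⟩⟩
  · have ht0 := ht.1
    refine (H0 l hl t ht).trans ?_
    gcongr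
    have : 0 ≤ K / p + γ * C1 := by positivity
    linarith
  · have ht0 := ht.1
    have H := mkODE hw hg wp gp heq hM N l (hK l)
    have s := H.step1 (by positivity) hp hK0 t ht
    have b := H1 l hl t ht
    rw [cf_DD hw wp l 0 N t (h1 t ht), cf_DD hw wp l 1 N t (h1 t ht)] at s
    rw [← norm_Il, ← norm_mul]
    have e := norm_sub_norm_le ((Complex.I * l) ^ N * cf (DD 1 0 w) l t)
      (((γ * l.natAbs : ℝ) : ℂ) * ((Complex.I * l) ^ N * cf (DD 0 0 w) l t))
    rw [norm_mul ((γ * l.natAbs : ℝ) : ℂ), norm_mul _ (cf (DD 0 0 w) l t), norm_Il,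
      Complex.norm_real, Real.norm_of_nonneg (by positivity)] at e
    have e2 : γ * l.natAbs * ((l.natAbs : ℝ) ^ N * ‖cf (DD 0 0 w) l t‖)
        = γ * ((l.natAbs : ℝ) ^ (N+1) * ‖cf (DD 0 0 w) l t‖) := by ring
    have e3 : γ * ((l.natAbs : ℝ) ^ (N+1) * ‖cf (DD 0 0 w) l t‖) ≤ γ * (C1 * t ^ p) := by gcongr
    have e4 : K / (γ * l.natAbs + p) * t ^ p ≤ K / p * t ^ p := by
      gcongr
      have : 0 ≤ γ * l.natAbs := by positivity
      linarith
    have e5 : 0 ≤ C0 * t ^ p := by positivity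
    nlinarith

lemma remainder {γ p : ℝ} (hγ : 0 < γ) (hp : 0 < p) (hres : ∀ k : ℕ, γ * k ≠ p) {w g}
    (hw : Sm w) (hg : Sm g) (wp : Per w) (gp : Per g)
    (heq : EqOm (pdRho (pdRho w) + γ ^ 2 • pdTheta (pdTheta w)) g) {M : ℝ}
    (hM : ∀ ρ ∈ Ioo (0:ℝ) (1/2), ∀ θ, |w ρ θ| ≤ M) (hO : Otilde p g) :
    ∃ c : ℤ → ℂ, (∀ l, p < γ * l.natAbs → c l = 0) ∧
      ∀ k N : ℕ, ∃ D : ℝ, 0 ≤ D ∧ ∀ l : ℤ, ∀ t ∈ Ioo (0:ℝ) (1/2),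
        (l.natAbs : ℝ) ^ N * ‖cf (DD k 0 w) l t -
          ((γ * l.natAbs : ℝ) : ℂ) ^ k * c l * (t ^ (γ * l.natAbs) : ℝ)‖ ≤ D * t ^ p := by
  have low : ∀ l : ℤ, ∃ (c : ℂ) (C : ℝ), (p < γ * l.natAbs → c = 0) ∧ (γ * l.natAbs < p →
      ∀ t ∈ Ioo (0:ℝ) (1/2), ‖cf (DD 0 0 w) l t - c * (t ^ (γ * l.natAbs) : ℝ)‖ ≤ C * t ^ p ∧
      ‖cf (DD 1 0 w) l t - (γ * l.natAbs : ℝ) * c * (t ^ (γ * l.natAbs) : ℝ)‖ ≤ C * t ^ p) := by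
    intro l
    by_cases hl : γ * l.natAbs < p
    · obtain ⟨K, hK0, hK⟩ := cf_bound hg gp hO 0 0
      have H := mkODE hw hg wp gp heq hM 0 l (hK l)
      obtain ⟨c, C, hc⟩ := H.low (by positivity) hp hK0 hl
      exact ⟨c, C, fun h => absurd h hl.not_gt, fun _ => hc⟩
    · exact ⟨0, 0, fun _ => rfl, fun h => absurd h hl⟩
  choose c C hc0 hcl using low
  refine ⟨c, hc0, ?_⟩
  set S : Finset ℤ := Finset.Icc (-(⌈p / γ⌉₊ : ℤ)) ⌈p / γ⌉₊ with hS
  have hSm : ∀ l : ℤ, γ * l.natAbs < p → l ∈ S := by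
    intro l hl
    have h1 : (l.natAbs : ℝ) ≤ p / γ := by rw [le_div_iff₀ hγ]; linarith
    have h2 : l.natAbs ≤ ⌈p / γ⌉₊ := by
      exact_mod_cast h1.trans (Nat.le_ceil _)
    rw [hS, Finset.mem_Icc]
    omega
  let P : ℕ → Prop := fun k => ∀ N : ℕ, ∃ D : ℝ, 0 ≤ D ∧ ∀ l : ℤ, ∀ t ∈ Ioo (0:ℝ) (1/2),
        (l.natAbs : ℝ) ^ N * ‖cf (DD k 0 w) l t -
          ((γ * l.natAbs : ℝ) : ℂ) ^ k * c l * (t ^ (γ * l.natAbs) : ℝ)‖ ≤ D * t ^ p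
  have base : ∀ N : ℕ, ∃ D : ℝ, 0 ≤ D ∧ ∀ l : ℤ, ∀ t ∈ Ioo (0:ℝ) (1/2),
        (l.natAbs : ℝ) ^ N * ‖cf (DD 0 0 w) l t - c l * (t ^ (γ * l.natAbs) : ℝ)‖ ≤ D * t ^ p ∧
        (l.natAbs : ℝ) ^ N * ‖cf (DD 1 0 w) l t -
          (γ * l.natAbs : ℝ) * c l * (t ^ (γ * l.natAbs) : ℝ)‖ ≤ D * t ^ p := by
    intro N
    obtain ⟨Ch, hCh, hh⟩ := high hγ hp hw hg wp gp heq hM hO N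
    have hsum : 0 ≤ ∑ l ∈ S, (l.natAbs : ℝ) ^ N * |C l| := by positivity
    refine ⟨Ch + ∑ l ∈ S, (l.natAbs : ℝ) ^ N * |C l|, by positivity, fun l t ht => ?_⟩
    have ht0 := ht.1
    have htp : 0 < t ^ p := by positivity
    rcases lt_or_gt_of_ne (hres l.natAbs) with hl | hl
    · have hle : (l.natAbs : ℝ) ^ N * |C l| ≤ ∑ l ∈ S, (l.natAbs : ℝ) ^ N * |C l| :=
        Finset.single_le_sum (f := fun l : ℤ => (l.natAbs : ℝ) ^ N * |C l|)
          (fun i _ => by positivity) (hSm l hl)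
      have gen : ∀ x : ℝ, x ≤ C l * t ^ p → (l.natAbs : ℝ) ^ N * x ≤
          (Ch + ∑ l ∈ S, (l.natAbs : ℝ) ^ N * |C l|) * t ^ p := by
        intro x hx
        calc (l.natAbs : ℝ) ^ N * x ≤ (l.natAbs : ℝ) ^ N * (|C l| * t ^ p) := by
              gcongr
              refine hx.trans ?_
              gcongr
              exact le_abs_self _
          _ = ((l.natAbs : ℝ) ^ N * |C l|) * t ^ p := by ring
          _ ≤ _ := by gcongr; linarith
      obtain ⟨b1, b2⟩ := hcl l hl t ht
      exact ⟨gen _ b1, gen _ b2⟩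
    · rw [hc0 l hl]
      obtain ⟨b1, b2⟩ := hh l hl t ht
      simp only [mul_zero, zero_mul, sub_zero]
      constructor <;> nlinarith
  have hP : ∀ k, P k ∧ P (k+1) := by
    intro k
    induction k with
    | zero =>
      constructor
      · intro N
        obtain ⟨D, hD0, hD⟩ := base N
        refine ⟨D, hD0, fun l t ht => ?_⟩
        have := (hD l t ht).1
        simpa using this
      · intro N
        obtain ⟨D, hD0, hD⟩ := base N
        refine ⟨D, hD0, fun l t ht => ?_⟩
        have := (hD l t ht).2
        simpa using this
    | succ k ih =>
      refine ⟨ih.2, fun N => ?_⟩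
      obtain ⟨D, hD0, hD⟩ := ih.1 (N+2)
      obtain ⟨K, hK0, hK⟩ := cf_bound hg gp hO k N
      refine ⟨γ ^ 2 * D + K, by positivity, fun l t ht => ?_⟩
      have ht1 : t ∈ Ioo (0:ℝ) 1 := ⟨ht.1, by linarith [ht.2]⟩
      have e0 : cf (DD (k+1+1) 0 w) l t = _ := cf_rec hw hg wp heq k l ht1
      rw [e0]
      set m : ℂ := ((γ * l.natAbs : ℝ) : ℂ) with hm
      have e1 : m ^ 2 * cf (DD k 0 w) l t + cf (DD k 0 g) l t -
          m ^ (k+1+1) * c l * (t ^ (γ * l.natAbs) : ℝ) =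
          m ^ 2 * (cf (DD k 0 w) l t - m ^ k * c l * (t ^ (γ * l.natAbs) : ℝ))
            + cf (DD k 0 g) l t := by ring
      rw [e1]
      have b1 := hD l t ht
      have b2 := hK l t ht
      rw [← hm] at b1
      have b3 := norm_add_le
        (m ^ 2 * (cf (DD k 0 w) l t - m ^ k * c l * (t ^ (γ * l.natAbs) : ℝ))) (cf (DD k 0 g) l t)
      have nm : ‖m ^ 2‖ = γ ^ 2 * (l.natAbs : ℝ) ^ 2 := by
        rw [norm_pow, hm, Complex.norm_real, Real.norm_of_nonneg (by positivity)]; ring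
      rw [norm_mul (m ^ 2), nm] at b3
      calc _ ≤ (l.natAbs : ℝ) ^ N * _ := mul_le_mul_of_nonneg_left b3 (by positivity)
        _ = γ ^ 2 * ((l.natAbs : ℝ) ^ (N+2) * ‖cf (DD k 0 w) l t -
              m ^ k * c l * (t ^ (γ * l.natAbs) : ℝ)‖)
            + (l.natAbs : ℝ) ^ N * ‖cf (DD k 0 g) l t‖ := by ring
        _ ≤ γ ^ 2 * (D * t ^ p) + K * t ^ p := by gcongr
        _ = _ := by ring
  exact fun k => (hP k).1

lemma key {γ p : ℝ} (hγ : 0 < γ) (hp : 0 < p) (hres : ∀ k : ℕ, γ * k ≠ p) {w g}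
    (hw : Sm w) (hg : Sm g) (wp : Per w) (gp : Per g)
    (heq : EqOm (pdRho (pdRho w) + γ ^ 2 • pdTheta (pdTheta w)) g) {M : ℝ}
    (hM : ∀ ρ ∈ Ioo (0:ℝ) (1/2), ∀ θ, |w ρ θ| ≤ M) (hO : Otilde p g) :
    ∃ (c : ℤ → ℂ) (S : Finset ℤ),
      Otilde p (w - ∑ l ∈ S, E (c l) (γ * l.natAbs) l) := by
  obtain ⟨c, hc0, hr⟩ := remainder hγ hp hres hw hg wp gp heq hM hO
  set S : Finset ℤ := Finset.Icc (-(⌈p / γ⌉₊ : ℤ)) ⌈p / γ⌉₊ with hS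
  have hSm : ∀ l : ℤ, l ∉ S → c l = 0 := by
    intro l hl
    apply hc0
    by_contra h
    push Not at h
    apply hl
    have h1 : (l.natAbs : ℝ) ≤ p / γ := by rw [le_div_iff₀ hγ]; linarith
    have h2 : l.natAbs ≤ ⌈p / γ⌉₊ := by
      exact_mod_cast h1.trans (Nat.le_ceil _)
    rw [hS, Finset.mem_Icc]
    omega
  refine ⟨c, S, fun k₁ k₂ => ?_⟩
  obtain ⟨D0, hD0, h0⟩ := hr k₁ k₂
  obtain ⟨D2, hD2, h2⟩ := hr k₁ (k₂ + 2)
  refine ⟨(D0 + D2) * ∑' l : ℤ, (1 + (l:ℝ)^2)⁻¹, fun ρ θ hρ hρ2 => ?_⟩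
  have hρ1 : ρ ∈ Ioo (0:ℝ) 1 := ⟨hρ, by linarith⟩
  have hEs : ∀ l ∈ S, Sm (E (c l) (γ * l.natAbs) l) := fun l _ => Sm.E _ _ _
  have e1 := DD_sub hw (Sm.sum S _ hEs) k₁ k₂ ρ hρ1 θ
  change |DD k₁ k₂ _ ρ θ| ≤ _
  rw [e1, Pi.sub_apply, Pi.sub_apply, DD_sum S _ hEs k₁ k₂ ρ hρ1 θ]
  simp only [Finset.sum_apply]
  rw [Finset.sum_congr rfl (fun l _ => DD_E (c l) (γ * l.natAbs) l k₁ k₂ ρ hρ1 θ)]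
  have s1 := hasSum_cf (hw.DD k₁ k₂) (wp.DD k₁ k₂) hρ1 θ
  have s2 : HasSum (fun l : ℤ => (((γ * l.natAbs : ℝ) : ℂ) ^ k₁ * ((Complex.I * l) ^ k₂ * c l))
      * ek l θ * (ρ ^ (γ * l.natAbs) : ℝ)) _ := hasSum_sum_of_ne_finset_zero (s := S) (by
        intro l hl
        rw [hSm l hl]; simp)
  have s3 := s1.sub s2
  have s4 := (summ_int.hasSum).mul_left ((D0 + D2) * ρ ^ p)
  have b := s3.norm_le_of_bounded s4 (by
    intro l
    have hρh : ρ ∈ Ioo (0:ℝ) (1/2) := ⟨hρ, hρ2⟩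
    have b0 := h0 l ρ hρh
    have b2 := h2 l ρ hρh
    rw [cf_DD hw wp l k₁ k₂ ρ hρ1]
    set X := cf (DD k₁ 0 w) l ρ - ((γ * l.natAbs : ℝ) : ℂ) ^ k₁ * c l * (ρ ^ (γ * l.natAbs) : ℝ)
      with hX
    have e : (Complex.I * l) ^ k₂ * cf (DD k₁ 0 w) l ρ * ek l θ -
        (((γ * l.natAbs : ℝ) : ℂ) ^ k₁ * ((Complex.I * l) ^ k₂ * c l)) * ek l θ *
          (ρ ^ (γ * l.natAbs) : ℝ) = (Complex.I * l) ^ k₂ * X * ek l θ := by rw [hX]; ring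
    rw [e, norm_mul, norm_ek, mul_one, norm_mul, norm_Il, ← div_eq_mul_inv,
      le_div_iff₀ (by positivity), ← sq_natAbs]
    have : (l.natAbs : ℝ) ^ k₂ * ‖X‖ * (1 + (l.natAbs : ℝ) ^ 2) =
      (l.natAbs : ℝ) ^ k₂ * ‖X‖ + (l.natAbs : ℝ) ^ (k₂+2) * ‖X‖ := by ring
    rw [this]
    linarith)
  have e5 : DD k₁ k₂ w ρ θ - ∑ l ∈ S, E (((γ * l.natAbs : ℝ) : ℂ) ^ k₁ *
      ((Complex.I * l) ^ k₂ * c l)) (γ * l.natAbs) l ρ θ =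
      ((DD k₁ k₂ w ρ θ : ℂ) - ∑ l ∈ S, (((γ * l.natAbs : ℝ) : ℂ) ^ k₁ *
      ((Complex.I * l) ^ k₂ * c l)) * ek l θ * (ρ ^ (γ * l.natAbs) : ℝ)).re := by
    rw [Complex.sub_re, Complex.ofReal_re, Complex.re_sum]
    congr 1
    refine Finset.sum_congr rfl fun l _ => ?_
    rw [Complex.re_mul_ofReal]
    rfl
  rw [e5]
  refine (Complex.abs_re_le_norm _).trans (b.trans (le_of_eq ?_))
  ring

end ConeAux

namespace ConeAux

lemma Otilde.congr {p : ℝ} {u v} (h : EqOm u v) (hv : Otilde p v) : Otilde p u := by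
  intro k₁ k₂
  obtain ⟨C, hC⟩ := hv k₁ k₂
  refine ⟨C, fun ρ θ h0 h1 => ?_⟩
  have := h.DD k₁ k₂ ρ ⟨h0, by linarith⟩ θ
  unfold DD at this
  rw [this]
  exact hC ρ θ h0 h1

lemma Otilde.mono {p p' : ℝ} {u} (h : p' ≤ p) (hu : Otilde p u) : Otilde p' u := by
  intro k₁ k₂
  obtain ⟨C, hC⟩ := hu k₁ k₂
  refine ⟨|C|, fun ρ θ h0 h1 => (hC ρ θ h0 h1).trans ?_⟩
  have e1 : ρ ^ p ≤ ρ ^ p' := Real.rpow_le_rpow_of_exponent_ge h0 (by linarith) h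
  have e2 : 0 ≤ ρ ^ p := Real.rpow_nonneg h0.le _
  have e3 := le_abs_self C
  have e4 := abs_nonneg C
  nlinarith

lemma Otilde.add {p : ℝ} {u v} (su : Sm u) (sv : Sm v) (hu : Otilde p u) (hv : Otilde p v) :
    Otilde p (u + v) := by
  intro k₁ k₂
  obtain ⟨C, hC⟩ := hu k₁ k₂
  obtain ⟨C', hC'⟩ := hv k₁ k₂
  refine ⟨C + C', fun ρ θ h0 h1 => ?_⟩
  have := DD_add su sv k₁ k₂ ρ ⟨h0, by linarith⟩ θ
  unfold DD at this
  rw [this]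
  refine (abs_add_le _ _).trans ?_
  have := hC ρ θ h0 h1
  have := hC' ρ θ h0 h1
  rw [add_mul]
  linarith

lemma Otilde.E {q s : ℝ} (c : ℂ) (l : ℤ) (h : q ≤ s) : Otilde q (E c s l) := by
  intro k₁ k₂
  refine ⟨‖(s:ℂ)^k₁ * ((Complex.I*l)^k₂ * c)‖, fun ρ θ h0 h1 => ?_⟩
  have := DD_E c s l k₁ k₂ ρ ⟨h0, by linarith⟩ θ
  unfold DD at this
  rw [this]
  refine (abs_E_le _ _ _ h0 θ).trans ?_
  gcongr ?_ * ?_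
  exact Real.rpow_le_rpow_of_exponent_ge h0 (by linarith) h

/-- multiplication by the square of the radius. -/
noncomputable def sqm (v : ℝ → ℝ → ℝ) : ℝ → ℝ → ℝ := fun ρ θ => ρ ^ 2 * v ρ θ

lemma Sm.sqm {v} (h : Sm v) : Sm (sqm v) :=
  ContDiffOn.mul (contDiff_fst.pow 2).contDiffOn h

lemma Per.sqm {v} (h : Per v) : Per (sqm v) := fun ρ θ => by
  simp only [ConeAux.sqm]; rw [h ρ θ]

lemma pdTheta_sqm (v) : pdTheta (sqm v) = sqm (pdTheta v) := by
  ext ρ θ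
  simp only [pdTheta, sqm]
  rw [deriv_const_mul_field]

lemma iterTheta_sqm (v) (k : ℕ) : pdTheta^[k] (sqm v) = sqm (pdTheta^[k] v) := by
  induction k with
  | zero => rfl
  | succ k ih => rw [Function.iterate_succ_apply', Function.iterate_succ_apply', ih, pdTheta_sqm]

lemma pdRho_sqm {v} (h : Sm v) : EqOm (pdRho (sqm v)) (sqm (pdRho v + (2:ℝ) • v)) := by
  intro ρ hρ θ
  have h1 := (hasDerivAt_pow 2 ρ).mul (h.hasRho' hρ θ)
  have h2 : deriv (fun r => sqm v r θ) ρ = _ := h1.deriv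
  have := hρ.1.ne'
  change ρ * deriv (fun r => sqm v r θ) ρ = _
  rw [h2]
  simp only [sqm, Pi.add_apply, Pi.smul_apply, smul_eq_mul]
  field_simp
  ring

lemma iterRho_sqm {q : ℝ} (k : ℕ) : ∀ {v}, Sm v → (∀ j : ℕ, ∃ C : ℝ, ∀ ρ θ : ℝ, 0 < ρ → ρ < 1 / 2 →
    |pdRho^[j] v ρ θ| ≤ C * ρ ^ q) → ∃ C : ℝ, ∀ ρ θ : ℝ, 0 < ρ → ρ < 1 / 2 →
    |pdRho^[k] (sqm v) ρ θ| ≤ C * ρ ^ (q + 2) := by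
  induction k with
  | zero =>
    intro v hv h
    obtain ⟨C, hC⟩ := h 0
    refine ⟨C, fun ρ θ h0 h1 => ?_⟩
    have := hC ρ θ h0 h1
    simp only [Function.iterate_zero, id, sqm] at this ⊢
    rw [abs_mul, abs_of_pos (by positivity), Real.rpow_add h0, Real.rpow_two]
    nlinarith [sq_nonneg ρ]
  | succ k ih =>
    intro v hv h
    have sv : Sm (pdRho v + (2:ℝ) • v) := hv.pdRho.add (hv.smul 2)
    obtain ⟨C, hC⟩ := ih sv (by
      intro j
      obtain ⟨C, hC⟩ := h (j+1)
      obtain ⟨C', hC'⟩ := h j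
      refine ⟨C + 2 * C', fun ρ θ h0 h1 => ?_⟩
      have hρ : ρ ∈ Ioo (0:ℝ) 1 := ⟨h0, by linarith⟩
      rw [iterRho_add hv.pdRho (hv.smul 2) j ρ hρ θ, Pi.add_apply, Pi.add_apply,
        iterRho_smul 2 hv j ρ hρ θ]
      have e1 := hC ρ θ h0 h1
      have e2 := hC' ρ θ h0 h1
      rw [Function.iterate_succ_apply] at e1
      simp only [Pi.smul_apply, smul_eq_mul]
      refine (abs_add_le _ _).trans ?_
      rw [abs_mul, abs_two]
      linarith)
    refine ⟨C, fun ρ θ h0 h1 => ?_⟩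
    rw [Function.iterate_succ_apply, (pdRho_sqm hv).iterRho k ρ ⟨h0, by linarith⟩ θ]
    exact hC ρ θ h0 h1

lemma Otilde.sqm {q : ℝ} {v} (hv : Sm v) (h : Otilde q v) : Otilde (q + 2) (sqm v) := by
  intro k₁ k₂
  rw [iterTheta_sqm]
  exact iterRho_sqm k₁ (hv.iterTheta k₂) fun j => h j k₂

/-- index set of the expansion. -/
def goodSet (β q : ℝ) : Set (ℕ × ℕ × ℕ) := {i | goodIdx β q i.1 i.2.1 i.2.2}

lemma goodSet_finite {β : ℝ} (hβ : -1 < β) (q : ℝ) : (goodSet β q).Finite := by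
  have hb : 0 < β + 1 := by linarith
  obtain ⟨N, hN⟩ := exists_nat_gt (max (q) (q * (β + 1)))
  refine ((Set.finite_Iio N).prod ((Set.finite_Iio N).prod (Set.finite_Iio N))).subset ?_
  rintro ⟨j, k, l⟩ ⟨⟨m, hm⟩, h⟩
  simp only at hm h
  have h1 : (0:ℝ) ≤ (k:ℝ) / (β + 1) := by positivity
  have h2 : (0:ℝ) ≤ j := by positivity
  have hk : (k:ℝ) < N := by
    have : (k:ℝ) / (β + 1) < q := by linarith
    rw [div_lt_iff₀ hb] at this
    exact this.trans ((le_max_right _ _).trans_lt hN)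
  have hj : (j:ℝ) < N := by
    have : (j:ℝ) < q := by linarith
    exact this.trans ((le_max_left _ _).trans_lt hN)
  have hk' : k < N := by exact_mod_cast hk
  have hj' : j < N := by exact_mod_cast hj
  simp only [Set.mem_prod, Set.mem_Iio]
  omega

/-- the exponent attached to an index. -/
noncomputable def ex (β : ℝ) (i : ℕ × ℕ × ℕ) : ℝ := 2 * (i.1 : ℝ) + (i.2.1 : ℝ) / (β + 1)

/-- the complex coefficient attached to real ones. -/
noncomputable def cc (a b : ℕ → ℕ → ℕ → ℝ) (i : ℕ × ℕ × ℕ) : ℂ :=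
  a i.1 i.2.1 i.2.2 - Complex.I * b i.1 i.2.1 i.2.2

lemma E_eq (a b s : ℝ) (l : ℕ) (ρ θ : ℝ) :
    E ((a:ℂ) - Complex.I * b) s l ρ θ = a * ρ ^ s * Real.cos (l * θ) + b * ρ ^ s * Real.sin (l * θ) := by
  have : Complex.exp (Complex.I * ((l:ℤ):ℂ) * θ) = Real.cos (l * θ) + Real.sin (l * θ) * Complex.I := by
    rw [Complex.ofReal_cos, Complex.ofReal_sin, ← Complex.exp_mul_I]
    congr 1; push_cast; ring
  simp only [E]
  rw [this]
  simp only [Complex.mul_re, Complex.add_re, Complex.sub_re, Complex.sub_im, Complex.add_im,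
    Complex.ofReal_re, Complex.ofReal_im, Complex.I_re, Complex.I_im, Complex.mul_im]
  ring

lemma expSum_eq {β q : ℝ} (hβ : -1 < β) {a b : ℕ → ℕ → ℕ → ℝ}
    (h : ∀ j k l : ℕ, ¬ goodIdx β q j k l → a j k l = 0 ∧ b j k l = 0) :
    expSum β a b = ∑ i ∈ (goodSet_finite hβ q).toFinset, E (cc a b i) (ex β i) (i.2.2 : ℕ) := by
  ext ρ θ
  rw [expSum, finsum_eq_sum_of_support_subset (s := (goodSet_finite hβ q).toFinset)]
  · simp only [Finset.sum_apply]
    refine Finset.sum_congr rfl fun i _ => ?_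
    rw [cc, E_eq]
    rfl
  · intro i hi
    by_contra hc
    simp only [Set.Finite.coe_toFinset] at hc
    obtain ⟨h1, h2⟩ := h _ _ _ hc
    apply hi
    simp only [h1, h2]; ring

lemma HasExpansion.of_O {β q : ℝ} {u} (h : Otilde q u) : HasExpansion β q u := by
  refine ⟨0, 0, fun _ _ _ _ => ⟨rfl, rfl⟩, ?_⟩
  have : (fun ρ θ => u ρ θ - expSum β 0 0 ρ θ) = u := by
    ext ρ θ
    simp [expSum]
  rwa [this]

lemma HasExpansion.congr {β q : ℝ} {u v} (h : EqOm u v) (hv : HasExpansion β q v) :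
    HasExpansion β q u := by
  obtain ⟨a, b, h1, h2⟩ := hv
  refine ⟨a, b, h1, Otilde.congr ?_ h2⟩
  intro ρ hρ θ
  simp only [h ρ hρ θ]

lemma Sm.expSum {β q : ℝ} (hβ : -1 < β) {a b : ℕ → ℕ → ℕ → ℝ}
    (h : ∀ j k l : ℕ, ¬ goodIdx β q j k l → a j k l = 0 ∧ b j k l = 0) : Sm (expSum β a b) := by
  rw [expSum_eq hβ h]
  exact Sm.sum _ _ fun i _ => Sm.E _ _ _

lemma HasExpansion.add {β q : ℝ} (hβ : -1 < β) {u v} (su : Sm u) (sv : Sm v)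
    (hu : HasExpansion β q u) (hv : HasExpansion β q v) : HasExpansion β q (u + v) := by
  obtain ⟨a, b, h1, h2⟩ := hu
  obtain ⟨a', b', h1', h2'⟩ := hv
  have h3 : ∀ j k l : ℕ, ¬ goodIdx β q j k l → (a + a') j k l = 0 ∧ (b + b') j k l = 0 := by
    intro j k l h
    obtain ⟨x1, x2⟩ := h1 j k l h
    obtain ⟨y1, y2⟩ := h1' j k l h
    simp [x1, x2, y1, y2]
  refine ⟨a + a', b + b', h3, ?_⟩
  have := Otilde.add (su.sub (Sm.expSum hβ h1)) (sv.sub (Sm.expSum hβ h1')) h2 h2'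
  convert this using 1
  ext ρ θ
  have e : expSum β (a+a') (b+b') ρ θ = expSum β a b ρ θ + expSum β a' b' ρ θ := by
    rw [expSum_eq hβ h1, expSum_eq hβ h1', expSum_eq hβ h3]
    simp only [Finset.sum_apply, ← Finset.sum_add_distrib]
    refine Finset.sum_congr rfl fun i _ => ?_
    simp only [cc, E_eq, Pi.add_apply]
    ring
  rw [e]
  simp only [Pi.add_apply, Pi.sub_apply]
  ring

lemma HasExpansion.sum {β q : ℝ} (hβ : -1 < β) {ι : Type*} (I : Finset ι) (F : ι → ℝ → ℝ → ℝ)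
    (s : ∀ i ∈ I, Sm (F i)) (h : ∀ i ∈ I, HasExpansion β q (F i)) :
    HasExpansion β q (∑ i ∈ I, F i) := by
  classical
  induction I using Finset.induction_on with
  | empty =>
    simp only [Finset.sum_empty]
    have := Otilde.E (q := q) 0 0 le_rfl
    refine HasExpansion.of_O (Otilde.congr ?_ this)
    intro ρ hρ θ
    simp [E]
  | insert a t ha ih =>
    rw [Finset.sum_insert ha]
    exact HasExpansion.add hβ (s a (by simp)) (Sm.sum _ _ fun i hi => s i (by simp [hi]))
      (h a (by simp)) (ih (fun i hi => s i (by simp [hi])) fun i hi => h i (by simp [hi]))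

lemma HasExpansion.E {β q : ℝ} (c : ℂ) (j k l : ℕ) (hp : ∃ m : ℕ, k = l + 2 * m) :
    HasExpansion β q (E c (2 * (j:ℝ) + (k:ℝ) / (β + 1)) l) := by
  classical
  by_cases hg : goodIdx β q j k l
  · refine ⟨fun j' k' l' => if j' = j ∧ k' = k ∧ l' = l then c.re else 0,
      fun j' k' l' => if j' = j ∧ k' = k ∧ l' = l then - c.im else 0, ?_, ?_⟩
    · intro j' k' l' h
      have : ¬ (j' = j ∧ k' = k ∧ l' = l) := by
        rintro ⟨rfl, rfl, rfl⟩; exact h hg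
      simp [this]
    · have := Otilde.E (q := q) 0 0 le_rfl
      refine Otilde.congr ?_ this
      intro ρ hρ θ
      simp only [expSum]
      rw [finsum_eq_single _ (j, k, l)]
      · have : c = (c.re : ℂ) - Complex.I * ((-c.im : ℝ) : ℂ) := by
          apply Complex.ext <;> simp
        conv_lhs => rw [this, E_eq]
        simp [ConeAux.E]
      · rintro ⟨j', k', l'⟩ h
        have : ¬ (j' = j ∧ k' = k ∧ l' = l) := by
          rintro ⟨rfl, rfl, rfl⟩; exact h rfl
        simp [this]
  · refine HasExpansion.of_O (Otilde.E _ _ ?_)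
    by_contra hc
    exact hg ⟨hp, not_le.mp hc⟩

lemma E_neg (c : ℂ) (s : ℝ) (l : ℤ) : ConeAux.E c s (-l) = ConeAux.E (starRingEnd ℂ c) s l := by
  ext ρ θ
  simp only [E]
  congr 1
  rw [← Complex.conj_re]
  congr 1
  rw [map_mul, ← Complex.exp_conj]
  congr 2
  simp

lemma HasExpansion.Eint {β q : ℝ} (c : ℂ) (l : ℤ) :
    HasExpansion β q (ConeAux.E c ((1 / (β + 1)) * l.natAbs) l) := by
  have e : (1 / (β + 1)) * (l.natAbs : ℝ) = 2 * ((0:ℕ):ℝ) + (l.natAbs : ℝ) / (β + 1) := by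
    push_cast; ring
  rw [e]
  rcases Int.natAbs_eq l with h | h
  · have := HasExpansion.E (β := β) (q := q) c 0 l.natAbs l.natAbs ⟨0, rfl⟩
    rwa [← h] at this
  · have := HasExpansion.E (β := β) (q := q) (starRingEnd ℂ c) 0 l.natAbs l.natAbs ⟨0, rfl⟩
    rwa [← E_neg, ← h] at this

/-- the model operator. -/
noncomputable def LL (γ : ℝ) (u : ℝ → ℝ → ℝ) : ℝ → ℝ → ℝ :=
  pdRho (pdRho u) + γ ^ 2 • pdTheta (pdTheta u)

lemma LL_eq (γ : ℝ) (u) : LL γ u = DD 2 0 u + γ ^ 2 • DD 0 2 u := rfl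

lemma LL_sub {γ : ℝ} {u v} (hu : Sm u) (hv : Sm v) : EqOm (LL γ (u - v)) (LL γ u - LL γ v) := by
  intro ρ hρ θ
  simp only [LL_eq, Pi.add_apply, Pi.sub_apply, Pi.smul_apply, smul_eq_mul]
  rw [DD_sub hu hv 2 0 ρ hρ θ, DD_sub hu hv 0 2 ρ hρ θ]
  simp only [Pi.sub_apply]
  ring

lemma LL_sum {γ : ℝ} {ι : Type*} (I : Finset ι) (F : ι → ℝ → ℝ → ℝ) (h : ∀ i ∈ I, Sm (F i)) :
    EqOm (LL γ (∑ i ∈ I, F i)) (∑ i ∈ I, LL γ (F i)) := by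
  intro ρ hρ θ
  simp only [LL_eq, Pi.add_apply, Pi.smul_apply, smul_eq_mul, Finset.sum_apply]
  rw [DD_sum I F h 2 0 ρ hρ θ, DD_sum I F h 0 2 ρ hρ θ]
  simp only [Finset.sum_apply, Finset.mul_sum, Finset.sum_add_distrib]

lemma LL_E {γ : ℝ} (c : ℂ) (s : ℝ) (l : ℤ) (h : (s + 2) ^ 2 - γ ^ 2 * (l:ℝ) ^ 2 ≠ 0) :
    EqOm (LL γ (ConeAux.E (c / (((s + 2) ^ 2 - γ ^ 2 * (l:ℝ) ^ 2 : ℝ) : ℂ)) (s + 2) l))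
      (sqm (ConeAux.E c s l)) := by
  intro ρ hρ θ
  simp only [LL_eq, Pi.add_apply, Pi.smul_apply, smul_eq_mul]
  rw [DD_E _ _ _ 2 0 ρ hρ θ, DD_E _ _ _ 0 2 ρ hρ θ]
  set d : ℝ := (s + 2) ^ 2 - γ ^ 2 * (l:ℝ) ^ 2 with hd
  have hd' : (d : ℂ) ≠ 0 := by exact_mod_cast h
  simp only [E, sqm]
  rw [Real.rpow_add hρ.1, Real.rpow_two]
  set X := Complex.exp (Complex.I * l * θ)
  have e1 : ((((s + 2 : ℝ)) : ℂ) ^ 2 * ((Complex.I * l) ^ 0 * (c / d)) * X) = (((s+2)^2/d : ℝ) : ℂ) * (c * X) := by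
    push_cast; field_simp
  have e2 : ((((s + 2 : ℝ)) : ℂ) ^ 0 * ((Complex.I * l) ^ 2 * (c / d)) * X) = ((-(l:ℝ)^2/d : ℝ) : ℂ) * (c * X) := by
    push_cast; rw [mul_pow, Complex.I_sq]; field_simp
  rw [e1, e2, Complex.re_ofReal_mul, Complex.re_ofReal_mul]
  have : (s+2)^2 = d + γ^2 * (l:ℝ)^2 := by rw [hd]; ring
  rw [this]
  field_simp
  ring

end ConeAux

namespace ConeAux

lemma pde {β : ℝ} (hβ : -1 < β) {w f : ℝ → ℝ → ℝ} (hw : Sm w)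
    (heq : ∀ ρ θ : ℝ, 0 < ρ → ρ ≤ 1 → coneLapW β w ρ θ = f ρ θ) :
    EqOm (LL (1 / (β + 1)) w) (sqm f) := by
  intro ρ hρ θ
  have hb : β + 1 ≠ 0 := by linarith
  have hn := hρ.1.ne'
  have h1 := heq ρ θ hρ.1 hρ.2.le
  have d1 : ∀ (u : ℝ → ℝ → ℝ) (r : ℝ), r ∈ Ioo (0:ℝ) 1 → dR u r θ = deriv (fun r => u r θ) r := by
    intro u r hr
    exact derivWithin_of_mem_nhds (Ioc_mem_nhds hr.1 hr.2)
  have d2 : ∀ r ∈ Ioo (0:ℝ) 1, dR w r θ = r⁻¹ * pdRho w r θ := by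
    intro r hr
    rw [d1 w r hr, (hw.hasRho' hr θ).deriv]
  have d3 : dR (dR w) ρ θ = -(ρ ^ 2)⁻¹ * pdRho w ρ θ + ρ⁻¹ * (ρ⁻¹ * pdRho (pdRho w) ρ θ) := by
    rw [d1 _ ρ hρ]
    have : (fun r => dR w r θ) =ᶠ[nhds ρ] (fun r => r⁻¹ * pdRho w r θ) := by
      filter_upwards [isOpen_Ioo.mem_nhds hρ] with r hr using d2 r hr
    rw [this.deriv_eq]
    exact ((hasDerivAt_inv hn).mul (hw.pdRho.hasRho' hρ θ)).deriv
  rw [coneLapW, d3, d2 ρ hρ] at h1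
  simp only [LL, sqm, Pi.add_apply, Pi.smul_apply, smul_eq_mul]
  rw [← h1]
  field_simp
  ring

lemma outer {β q : ℝ} (hβ : -1 < β) {w f : ℝ → ℝ → ℝ}
    (hw : Sm w) (sf : Sm f) (hwper : Per w) (hfper : Per f)
    {M : ℝ} (hM : ∀ ρ θ : ℝ, 0 < ρ → ρ ≤ 1 → |w ρ θ| ≤ M)
    (hf : HasExpansion β q f) (heq : EqOm (LL (1 / (β + 1)) w) (sqm f))
    {p q' : ℝ} (hp : 0 < p) (hpq : p ≤ q + 2) (hres : ∀ k : ℕ, 1 / (β + 1) * k ≠ p) (hq' : q' ≤ p) :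
    HasExpansion β q' w := by
  have hb : 0 < β + 1 := by linarith
  obtain ⟨a, b, hab, hO⟩ := hf
  set γ := 1 / (β + 1) with hγ
  have hγ0 : 0 < γ := by positivity
  set I := (goodSet_finite hβ q).toFinset with hI
  set d : ℕ × ℕ × ℕ → ℝ := fun i => (ex β i + 2) ^ 2 - γ ^ 2 * (((i.2.2 : ℕ) : ℤ) : ℝ) ^ 2 with hd
  have hex : ∀ i, 0 ≤ ex β i := by intro i; unfold ex; positivity
  have par : ∀ i ∈ I, ∃ m : ℕ, i.2.1 = i.2.2 + 2 * m := by
    intro i hi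
    rw [hI, Set.Finite.mem_toFinset] at hi
    exact hi.1
  have hd0 : ∀ i ∈ I, d i ≠ 0 := by
    intro i hi
    obtain ⟨m, hm⟩ := par i hi
    have h1 : ((i.2.2 : ℕ) : ℝ) ≤ i.2.1 := by exact_mod_cast (by omega)
    have h2 : γ * (i.2.2 : ℕ) < ex β i + 2 := by
      have : γ * (i.2.2 : ℕ) ≤ γ * i.2.1 := by gcongr
      have h3 : γ * i.2.1 = (i.2.1 : ℝ) / (β + 1) := by rw [hγ]; ring
      have h4 : (0:ℝ) ≤ i.1 := by positivity
      unfold ex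
      linarith
    have h5 : 0 ≤ γ * (i.2.2 : ℕ) := by positivity
    have : 0 < d i := by
      simp only [hd, Int.cast_natCast]
      nlinarith
    exact this.ne'
  set F : ℕ × ℕ × ℕ → ℝ → ℝ → ℝ := fun i => E (cc a b i / (d i : ℂ)) (ex β i + 2) (i.2.2 : ℕ) with hF
  have sF : ∀ i ∈ I, Sm (F i) := fun i _ => Sm.E _ _ _
  set P := ∑ i ∈ I, F i with hP
  have sP : Sm P := Sm.sum _ _ sF
  have pP : Per P := Per.sum _ _ fun i _ => Per.E _ _ _
  have eP : HasExpansion β q' P := by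
    refine HasExpansion.sum hβ _ _ sF fun i hi => ?_
    have := HasExpansion.E (β := β) (q := q') (cc a b i / (d i : ℂ)) (i.1 + 1) i.2.1 i.2.2 (par i hi)
    convert this using 2
    simp only [ex]; push_cast; ring
  have es := expSum_eq hβ hab
  have sE : Sm (expSum β a b) := Sm.expSum hβ hab
  have pE : Per (expSum β a b) := by rw [es]; exact Per.sum _ _ fun i _ => Per.E _ _ _
  have LP : EqOm (LL γ P) (sqm (expSum β a b)) := by
    refine (LL_sum I F sF).trans ?_
    intro ρ hρ θ
    rw [es]
    simp only [sqm, Finset.sum_apply, Finset.mul_sum]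
    refine Finset.sum_congr rfl fun i hi => ?_
    exact LL_E (cc a b i) (ex β i) (i.2.2 : ℕ) (hd0 i hi) ρ hρ θ
  have sg : Sm (sqm (f - expSum β a b)) := (sf.sub sE).sqm
  have heq2 : EqOm (pdRho (pdRho (w - P)) + γ ^ 2 • pdTheta (pdTheta (w - P)))
      (sqm (f - expSum β a b)) := by
    intro ρ hρ θ
    have := LL_sub (γ := γ) hw sP ρ hρ θ
    rw [LL] at this
    rw [this, Pi.sub_apply, Pi.sub_apply, heq ρ hρ θ, LP ρ hρ θ]
    simp only [sqm, Pi.sub_apply]; ring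
  have hO2 : Otilde p (sqm (f - expSum β a b)) := Otilde.mono hpq (Otilde.sqm (sf.sub sE) hO)
  have bd : ∀ ρ ∈ Ioo (0:ℝ) (1/2), ∀ θ, |(w - P) ρ θ| ≤ M + ∑ i ∈ I, ‖cc a b i / (d i : ℂ)‖ := by
    intro ρ hρ θ
    have h1 := hM ρ θ hρ.1 (by linarith [hρ.2])
    have h2 : |P ρ θ| ≤ ∑ i ∈ I, ‖cc a b i / (d i : ℂ)‖ := by
      rw [hP]
      simp only [Finset.sum_apply]
      refine (Finset.abs_sum_le_sum_abs _ _).trans (Finset.sum_le_sum fun i _ => ?_)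
      refine (abs_E_le _ _ _ hρ.1 θ).trans ?_
      apply mul_le_of_le_one_right (norm_nonneg _)
      exact Real.rpow_le_one hρ.1.le (by linarith [hρ.2]) (by linarith [hex i])
    simp only [Pi.sub_apply]
    exact (abs_sub _ _).trans (add_le_add h1 h2)
  obtain ⟨c, S, hS⟩ := key hγ0 hp hres (hw.sub sP) sg (hwper.sub pP) (hfper.sub pE).sqm heq2 bd hO2
  have sL : Sm (∑ l ∈ S, E (c l) (γ * l.natAbs) l) := Sm.sum _ _ fun i _ => Sm.E _ _ _
  have eL : HasExpansion β q' (∑ l ∈ S, E (c l) (γ * l.natAbs) l) :=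
    HasExpansion.sum hβ _ _ (fun i _ => Sm.E _ _ _) fun l _ => HasExpansion.Eint _ _
  have eR : HasExpansion β q' (w - P - ∑ l ∈ S, E (c l) (γ * l.natAbs) l) :=
    HasExpansion.of_O (Otilde.mono hq' hS)
  have := HasExpansion.add hβ (((hw.sub sP).sub sL).add sL) sP
    (HasExpansion.add hβ ((hw.sub sP).sub sL) sL eR eL) eP
  simpa using this

end ConeAux

/-- if `w` is bounded, `△̃w = f` on `{0 < ρ ≤ 1}`, and `f` has an expansion
up to order `q`, then `w` has an expansion up to order `q'` for every `q' < 2 + q`;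
in the non-resonant case `q ≠ k/(β+1) - 2` (all `k`), `w` has an expansion up to order `2 + q`. -/
theorem stmt7 (β q : ℝ) (hβ : -1 < β) (hq : 0 ≤ q) (w f : ℝ → ℝ → ℝ)
    (hwsmooth : ContDiffOn ℝ (⊤ : ℕ∞) (fun p : ℝ × ℝ => w p.1 p.2)
      {p : ℝ × ℝ | 0 < p.1 ∧ p.1 ≤ 1})
    (hfsmooth : ContDiffOn ℝ (⊤ : ℕ∞) (fun p : ℝ × ℝ => f p.1 p.2)
      {p : ℝ × ℝ | 0 < p.1 ∧ p.1 ≤ 1})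
    (hwper : ∀ ρ θ : ℝ, w ρ (θ + 2 * π) = w ρ θ)
    (hfper : ∀ ρ θ : ℝ, f ρ (θ + 2 * π) = f ρ θ)
    (hwbdd : ∃ M : ℝ, ∀ ρ θ : ℝ, 0 < ρ → ρ ≤ 1 → |w ρ θ| ≤ M)
    (hf : HasExpansion β q f)
    (heq : ∀ ρ θ : ℝ, 0 < ρ → ρ ≤ 1 → coneLapW β w ρ θ = f ρ θ) :
    (∀ q' : ℝ, 0 ≤ q' → q' < 2 + q → HasExpansion β q' w) ∧
    ((∀ k : ℕ, q ≠ (k : ℝ) / (β + 1) - 2) → HasExpansion β (2 + q) w) := by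
  have hb : 0 < β + 1 := by linarith
  have sub : Ioo (0:ℝ) 1 ×ˢ (univ : Set ℝ) ⊆ {p : ℝ × ℝ | 0 < p.1 ∧ p.1 ≤ 1} :=
    fun p hp => ⟨hp.1.1, hp.1.2.le⟩
  have hw : ConeAux.Sm w := hwsmooth.mono sub
  have sf : ConeAux.Sm f := hfsmooth.mono sub
  obtain ⟨M, hM⟩ := hwbdd
  have hpde := ConeAux.pde hβ hw heq
  constructor
  · intro q' h0 h1
    have hc : (range fun k : ℕ => 1 / (β + 1) * (k:ℝ)).Countable := countable_range _
    obtain ⟨p, hp, hpm⟩ := (hc.dense_compl ℝ).exists_between h1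
    refine ConeAux.outer hβ hw sf hwper hfper hM hf hpde (p := p) (by linarith [hpm.1])
      (by linarith [hpm.2]) ?_ hpm.1.le
    intro k hk
    exact hp ⟨k, hk⟩
  · intro h
    refine ConeAux.outer hβ hw sf hwper hfper hM hf hpde (p := 2 + q) (by linarith)
      (by linarith) ?_ le_rfl
    intro k hk
    apply h k
    rw [div_eq_mul_inv, mul_comm, ← one_div]
    linarith
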